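/- arXiv:0905.2013 — 2 statements merged into one kernel-verified Lean document; each statement's English description precedes it below -/
import Mathlib

section
/- Let n, k be nonnegative integers with n ≥ 2k. Then, as an identity of polynomials in q, ∑_{s=0}^{k} C(k,s) · ( ∑_{w ∈ Π_{n,k−s}} q^{maj(w⁻¹)} ) = [n]_q · [n−1]_q ⋯ [n−k+1]_q (the product having k factors). -/
open Polynomial

/-- `w` has an increasing subsequence of length `m`. -/
def HasIncSubseq {n : ℕ} (w : Equiv.Perm (Fin n)) (m : ℕ) : Prop :=
  ∃ f : Fin m → Fin n, StrictMono f ∧ StrictMono fun j => w (f j)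

/-- The length of the longest increasing subsequence of `w`. -/
noncomputable def isLen {n : ℕ} (w : Equiv.Perm (Fin n)) : ℕ :=
  sSup {m | HasIncSubseq w m}

/-- The first `n - s` values of `w` are increasing (positions `0,…,n-s-1` in 0-indexing,
i.e. `w(1) < ⋯ < w(n-s)` in 1-indexing). -/
def PrefixInc (n s : ℕ) (w : Equiv.Perm (Fin n)) : Prop :=
  ∀ i j : Fin n, (i : ℕ) < j → (j : ℕ) < n - s → w i < w j

/-- Major index of a permutation: the sum of the (1-indexed) descent positions.
Position `i ∈ {0,…,n-2}` (0-indexed) contributes `i + 1`. -/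
def maj {n : ℕ} (σ : Equiv.Perm (Fin n)) : ℕ :=
  ∑ i ∈ Finset.range n,
    if h : i + 1 < n then
      if σ ⟨i + 1, h⟩ < σ ⟨i, Nat.lt_of_succ_lt h⟩ then i + 1 else 0
    else 0

/-- The q-integer `[m]_q = 1 + q + ⋯ + q^{m-1}` as a polynomial in `q = X` over `ℤ`. -/
noncomputable def qInt (m : ℕ) : Polynomial ℤ :=
  ∑ i ∈ Finset.range m, (X : Polynomial ℤ) ^ i

/-- The set `Π_{n,k}` of permutations whose first `n - k` values are increasing and whose
longest increasing subsequence has length exactly `n - k`, as a `Finset`. -/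
noncomputable def PiFinset (n k : ℕ) : Finset (Equiv.Perm (Fin n)) :=
  @Finset.filter _ (fun w => PrefixInc n k w ∧ isLen w = n - k) (Classical.decPred _)
    Finset.univ

/-- The set `C_{n,s}` of permutations whose first `n - s` values are increasing,
as a `Finset`. -/
noncomputable def CFinset (n s : ℕ) : Finset (Equiv.Perm (Fin n)) :=
  @Finset.filter _ (fun w => PrefixInc n s w) (Classical.decPred _) Finset.univ

/-- The prefix `w(1),…,w(a)` (1-indexed) contains an increasing subsequence of length `m`. -/
def HasIncSubseqPrefix {n : ℕ} (w : Equiv.Perm (Fin n)) (a m : ℕ) : Prop :=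
  ∃ f : Fin m → Fin n, StrictMono f ∧ (∀ j, (f j : ℕ) < a) ∧ StrictMono fun j => w (f j)

/-- Membership in `C_{n,s,a}`: `π ∈ C_{n,s}`, the prefix of length `a` contains an increasing
subsequence of length `n - s + 1`, but the prefix of length `a - 1` does not. -/
def MemCa (n s a : ℕ) (π : Equiv.Perm (Fin n)) : Prop :=
  PrefixInc n s π ∧ HasIncSubseqPrefix π a (n - s + 1) ∧
    ¬ HasIncSubseqPrefix π (a - 1) (n - s + 1)

/-- The set `C_{n,s,a}` as a `Finset`. -/
noncomputable def CaFinset (n s a : ℕ) : Finset (Equiv.Perm (Fin n)) :=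
  @Finset.filter _ (fun π => MemCa n s a π) (Classical.decPred _) Finset.univ

/-- `j` is a descent of `σ` in 1-indexed positions. -/
def IsDescent {n : ℕ} (σ : Equiv.Perm (Fin n)) (j : ℕ) : Prop :=
  ∃ h : j < n, 0 < j ∧ σ ⟨j, h⟩ < σ ⟨j - 1, by omega⟩

open Classical in
lemma maj_eq_sum_isDescent {n : ℕ} (σ : Equiv.Perm (Fin n)) :
    maj σ = ∑ j ∈ Finset.range n, if IsDescent σ j then j else 0 := by
  have h1 : ∑ j ∈ Finset.range (n + 1), (if IsDescent σ j then j else 0) =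
      ∑ j ∈ Finset.range n, if IsDescent σ j then j else 0 := by
    rw [Finset.sum_range_succ]
    simp [IsDescent]
  rw [← h1, Finset.sum_range_succ', maj]
  simp only [ite_self, add_zero]
  refine Finset.sum_congr rfl fun i _ => ?_
  by_cases h : i + 1 < n
  · simp [IsDescent, h]
  · simp [IsDescent, h]

open Classical in
/-- Inserting a new maximum into the gap `p < m` of a word with descent set `d` changes the
major index to the sum below; over all gaps the changes are `1, …, m`. -/
lemma sum_pow_insert_max (d : ℕ → Prop) (m : ℕ) :
    ∑ p ∈ Finset.range m, (X : Polynomial ℤ) ^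
        (∑ j ∈ Finset.range m, if j < p then (if d j then j else 0)
          else if j = p then j + 1 else if d j then j + 1 else 0) =
      X * qInt m * X ^ (∑ j ∈ Finset.range m, if d j then j else 0) := by
  induction m with
  | zero => simp [qInt]
  | succ m ih =>
    rw [Finset.sum_range_succ]
    have hlast : (∑ j ∈ Finset.range (m + 1), if j < m then (if d j then j else 0)
          else if j = m then j + 1 else if d j then j + 1 else 0) =
        (∑ j ∈ Finset.range m, if d j then j else 0) + (m + 1) := by
      rw [Finset.sum_range_succ]
      congr 1
      · exact Finset.sum_congr rfl fun j hj => by rw [if_pos (Finset.mem_range.1 hj)]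
      · simp
    have hrest : ∀ p ∈ Finset.range m, (X : Polynomial ℤ) ^
        (∑ j ∈ Finset.range (m + 1), if j < p then (if d j then j else 0)
          else if j = p then j + 1 else if d j then j + 1 else 0) =
        X ^ (∑ j ∈ Finset.range m, if j < p then (if d j then j else 0)
          else if j = p then j + 1 else if d j then j + 1 else 0) *
          X ^ (if d m then m + 1 else 0) := by
      intro p hp
      have hp := Finset.mem_range.1 hp
      rw [Finset.sum_range_succ, pow_add, if_neg (by omega : ¬ m < p),
        if_neg (by omega : ¬ m = p)]
    rw [hlast, Finset.sum_congr rfl hrest, ← Finset.sum_mul, ih, Finset.sum_range_succ]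
    by_cases hd : d m
    · have : qInt (m + 1) = X * qInt m + 1 := by
        simp [qInt, Finset.sum_range_succ', pow_succ', Finset.mul_sum]
      simp only [hd, if_true, this]
      ring
    · have : qInt (m + 1) = qInt m + X ^ m := by
        simp [qInt, Finset.sum_range_succ]
      simp only [hd, if_false, this]
      ring

/-- The permutation of `Fin (n + 1)` with last value `v` whose other values are in the same
relative order as those of `w`. -/
def snocPerm {n : ℕ} (v : Fin (n + 1)) (w : Equiv.Perm (Fin n)) : Equiv.Perm (Fin (n + 1)) :=
  ((finSuccEquiv' (Fin.last n)).trans (Equiv.optionCongr w)).trans (finSuccEquiv' v).symm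

lemma snocPerm_last {n : ℕ} (v : Fin (n + 1)) (w : Equiv.Perm (Fin n)) :
    snocPerm v w (Fin.last n) = v := by
  simp [snocPerm]

lemma snocPerm_castSucc {n : ℕ} (v : Fin (n + 1)) (w : Equiv.Perm (Fin n)) (i : Fin n) :
    snocPerm v w i.castSucc = v.succAbove (w i) := by
  simp [snocPerm, finSuccEquiv'_last_apply_castSucc]

lemma snocPerm_inv_self {n : ℕ} (v : Fin (n + 1)) (w : Equiv.Perm (Fin n)) :
    (snocPerm v w)⁻¹ v = Fin.last n := by
  rw [Equiv.Perm.inv_eq_iff_eq, snocPerm_last]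

lemma snocPerm_inv_succAbove {n : ℕ} (v : Fin (n + 1)) (w : Equiv.Perm (Fin n)) (i : Fin n) :
    (snocPerm v w)⁻¹ (v.succAbove i) = (w⁻¹ i).castSucc := by
  rw [Equiv.Perm.inv_eq_iff_eq, snocPerm_castSucc]
  simp

lemma prefixInc_snocPerm {n k : ℕ} (v : Fin (n + 1)) (w : Equiv.Perm (Fin n)) :
    PrefixInc (n + 1) (k + 1) (snocPerm v w) ↔ PrefixInc n k w := by
  constructor
  · intro h i j hij hj
    have := h i.castSucc j.castSucc (by simpa using hij) (by simpa using hj)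
    rwa [snocPerm_castSucc, snocPerm_castSucc, Fin.succAbove_lt_succAbove_iff] at this
  · intro h i j hij hj
    have hj' : (j : ℕ) < n := by omega
    have hi' : (i : ℕ) < n := by omega
    rw [show i = (⟨i, hi'⟩ : Fin n).castSucc from rfl,
      show j = (⟨j, hj'⟩ : Fin n).castSucc from rfl, snocPerm_castSucc, snocPerm_castSucc, Fin.succAbove_lt_succAbove_iff]
    exact h _ _ hij (by simpa using hj)

lemma exists_snocPerm {n : ℕ} (w : Equiv.Perm (Fin (n + 1))) :
    ∃ v w', snocPerm v w' = w := by
  have h : ∀ i : Fin n, ∃ j, (w (Fin.last n)).succAbove j = w i.castSucc := fun i =>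
    Fin.exists_succAbove_eq fun h => (Fin.castSucc_lt_last i).ne (w.injective h)
  choose g hg using h
  have hinj : Function.Injective g := fun a b hab => by
    have : w a.castSucc = w b.castSucc := by rw [← hg, ← hg, hab]
    simpa using this
  refine ⟨w (Fin.last n), Equiv.ofBijective g (Finite.injective_iff_bijective.1 hinj), ?_⟩
  ext i
  induction i using Fin.lastCases with
  | last => rw [snocPerm_last]
  | cast i => rw [snocPerm_castSucc, ← hg]; rfl

lemma snocPerm_injective {n : ℕ} {v v' : Fin (n + 1)} {w w' : Equiv.Perm (Fin n)}
    (h : snocPerm v w = snocPerm v' w') : v = v' ∧ w = w' := by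
  have hv : v = v' := by
    rw [← snocPerm_last v w, h, snocPerm_last]
  subst hv
  refine ⟨rfl, Equiv.ext fun i => ?_⟩
  have := congrArg (fun p => p i.castSucc) h
  simpa [snocPerm_castSucc] using this

lemma isDescent_snocPerm_inv {n : ℕ} (v : Fin (n + 1)) (w : Equiv.Perm (Fin n)) (j : ℕ) :
    IsDescent (snocPerm v w)⁻¹ j ↔
      j < v ∧ IsDescent w⁻¹ j ∨ j = v + 1 ∧ j ≤ n ∨ (v : ℕ) + 1 < j ∧ IsDescent w⁻¹ (j - 1) := by
  have key : ∀ i : ℕ, ∀ h : i < n + 1, 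
      (i < v ∧ ∃ h' : i < n, (snocPerm v w)⁻¹ ⟨i, h⟩ = (w⁻¹ ⟨i, h'⟩).castSucc) ∨
      (i = v ∧ (snocPerm v w)⁻¹ ⟨i, h⟩ = Fin.last n) ∨
      ((v : ℕ) < i ∧ ∃ h' : i - 1 < n, (snocPerm v w)⁻¹ ⟨i, h⟩ = (w⁻¹ ⟨i - 1, h'⟩).castSucc) := by
    intro i h
    have hv := v.isLt
    rcases lt_trichotomy i v with hlt | heq | hgt
    · refine Or.inl ⟨hlt, by omega, ?_⟩
      rw [← snocPerm_inv_succAbove v w, Fin.succAbove_of_castSucc_lt]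
      · rfl
      · exact hlt
    · refine Or.inr (Or.inl ⟨heq, ?_⟩)
      rw [← snocPerm_inv_self v w]
      congr 1
      exact Fin.ext heq
    · refine Or.inr (Or.inr ⟨hgt, by omega, ?_⟩)
      rw [← snocPerm_inv_succAbove v w, Fin.succAbove_of_le_castSucc]
      · congr 1
        ext
        simp
        omega
      · rw [Fin.le_def]
        simp
        omega
  rcases Nat.eq_zero_or_pos j with rfl | hj
  · simp [IsDescent]
  by_cases hjn : j < n + 1
  · have h0 : IsDescent (snocPerm v w)⁻¹ j ↔
        (snocPerm v w)⁻¹ ⟨j, hjn⟩ < (snocPerm v w)⁻¹ ⟨j - 1, by omega⟩ := by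
      simp [IsDescent, hj, hjn]
    rw [h0]
    rcases key j hjn with ⟨h1, h1', e1⟩ | ⟨h1, e1⟩ | ⟨h1, h1', e1⟩ <;>
    rcases key (j - 1) (by omega) with ⟨h2, h2', e2⟩ | ⟨h2, e2⟩ | ⟨h2, h2', e2⟩ <;>
    try omega
    · have h3 : ¬ ((v : ℕ) + 1 < j) := by omega
      have h4 : ¬ (j = (v : ℕ) + 1) := by omega
      simp [e1, e2, IsDescent, hj, h1, h1', h3, h4]
    · have h3 : ¬ ((v : ℕ) + 1 < j) := by omega
      have h4 : ¬ (j < (v : ℕ)) := by omega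
      have h5 : ¬ (j = (v : ℕ) + 1) := by omega
      simp [e1, h3, h4, h5, Fin.le_last]
    · have h3 : j = (v : ℕ) + 1 ∧ j ≤ n := by omega
      rw [e1, e2]
      exact iff_of_true (Fin.castSucc_lt_last _) (Or.inr (Or.inl h3))
    · have h3 : ((v : ℕ) + 1 < j) := by omega
      have h4 : ¬ (j < (v : ℕ)) := by omega
      have h5 : ¬ (j = (v : ℕ) + 1) := by omega
      have h6 : 0 < j - 1 := by omega
      simp [e1, e2, IsDescent, h1', h3, h4, h5, h6]
  · have := v.isLt
    constructor
    · rintro ⟨h, -⟩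
      omega
    · rintro (⟨h, -⟩ | h | ⟨-, h, -⟩) <;> omega

open Classical in
lemma sum_snocPerm {n : ℕ} (w : Equiv.Perm (Fin n)) :
    ∑ v, (X : Polynomial ℤ) ^ maj (snocPerm v w)⁻¹ = qInt (n + 1) * X ^ maj w⁻¹ := by
  have hmaj : ∀ v : Fin (n + 1), maj (snocPerm v w)⁻¹ =
      ∑ j ∈ Finset.range n, if j < (v : ℕ) then (if IsDescent w⁻¹ j then j else 0)
        else if j = v then j + 1 else if IsDescent w⁻¹ j then j + 1 else 0 := by
    intro v
    rw [maj_eq_sum_isDescent, Finset.sum_range, Fin.sum_univ_succAbove _ v, Finset.sum_range]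
    rw [if_neg (by rw [isDescent_snocPerm_inv]; omega), zero_add]
    refine Finset.sum_congr rfl fun j _ => ?_
    have hj := j.isLt
    rcases lt_trichotomy (j : ℕ) v with h | h | h
    · have hd : IsDescent (snocPerm v w)⁻¹ j ↔ IsDescent w⁻¹ j := by
        rw [isDescent_snocPerm_inv]
        grind
      rw [Fin.succAbove_of_castSucc_lt _ _ h, Fin.val_castSucc, if_pos h]
      simp only [hd]
    · rw [Fin.succAbove_of_le_castSucc _ _ h.ge, Fin.val_succ, if_neg h.not_lt, if_pos h,
        if_pos (by rw [isDescent_snocPerm_inv]; omega)]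
    · have hd : IsDescent (snocPerm v w)⁻¹ (j + 1) ↔ IsDescent w⁻¹ j := by
        rw [isDescent_snocPerm_inv]
        grind
      rw [Fin.succAbove_of_le_castSucc _ _ h.le, Fin.val_succ, if_neg h.not_gt, if_neg h.ne']
      simp only [hd]
  rw [Fin.sum_univ_castSucc]
  have hlast : maj (snocPerm (Fin.last n) w)⁻¹ = maj w⁻¹ := by
    rw [hmaj, maj_eq_sum_isDescent]
    exact Finset.sum_congr rfl fun j hj => by simp [Finset.mem_range.1 hj]
  have h := sum_pow_insert_max (IsDescent w⁻¹) n
  rw [Finset.sum_range, ← maj_eq_sum_isDescent] at h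
  simp only [hmaj, Fin.val_castSucc] at hlast ⊢
  rw [h, hlast]
  have : qInt (n + 1) = X * qInt n + 1 := by
    simp [qInt, Finset.sum_range_succ', pow_succ', Finset.mul_sum]
  rw [this]
  ring

lemma maj_one (n : ℕ) : maj (1 : Equiv.Perm (Fin n)) = 0 := by
  simp [maj]

lemma sum_CFinset (k : ℕ) : ∀ n, k ≤ n →
    ∑ w ∈ CFinset n k, (X : Polynomial ℤ) ^ maj w⁻¹ = ∏ j ∈ Finset.range k, qInt (n - j) := by
  induction k with
  | zero =>
    intro n _
    have : CFinset n 0 = {1} := by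
      ext w
      simp only [CFinset, Finset.mem_filter, Finset.mem_univ, true_and, Finset.mem_singleton]
      constructor
      · intro h
        have hm : StrictMono w := fun i j hij => h i j hij j.isLt
        have : (hm.orderIsoOfSurjective w w.surjective) = OrderIso.refl _ := Subsingleton.elim _ _
        exact Equiv.ext fun i => congrArg (fun e : Fin n ≃o Fin n => e i) this
      · rintro rfl i j hij _
        exact hij
    simp [this, maj_one]
  | succ k ih =>
    intro n hn
    obtain ⟨n, rfl⟩ : ∃ m, n = m + 1 := ⟨n - 1, by omega⟩
    rw [Finset.prod_range_succ']
    simp only [Nat.add_sub_add_right, Nat.sub_zero]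
    rw [← ih n (by omega), Finset.sum_mul]
    simp only [mul_comm (X ^ _ : Polynomial ℤ) (qInt _), ← sum_snocPerm]
    rw [← Finset.sum_product']
    symm
    refine Finset.sum_bij (fun p _ => snocPerm p.2 p.1) ?_ ?_ ?_ ?_
    · intro p hp
      simpa [CFinset, prefixInc_snocPerm] using hp
    · rintro ⟨a, b⟩ _ ⟨c, d⟩ _ h
      obtain ⟨h1, h2⟩ := snocPerm_injective h
      exact Prod.ext h2 h1
    · intro w hw
      obtain ⟨v, w', rfl⟩ := exists_snocPerm w
      exact ⟨(w', v), by simpa [CFinset, prefixInc_snocPerm] using hw, rfl⟩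
    · intro p _
      rfl

lemma reduceOption_map_some {α : Type*} (l : List α) : (l.map some).reduceOption = l := by
  simp [List.reduceOption, List.filterMap_map]

/-- Schensted insertion of the letters of a word `u` into a row `R`, ending with the row `R'`.
The list records, letter by letter, the bumped entry, or `none` when the letter is appended. -/
inductive RowInsert : Finset ℕ → List ℕ → Finset ℕ → List (Option ℕ) → Prop
  | nil (R : Finset ℕ) : RowInsert R [] R []
  | append {R R' : Finset ℕ} {x : ℕ} {u : List ℕ} {ops : List (Option ℕ)}
      (hx : ∀ r ∈ R, r < x) (h : RowInsert (insert x R) u R' ops) :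
      RowInsert R (x :: u) R' (none :: ops)
  | bump {R R' : Finset ℕ} {x y : ℕ} {u : List ℕ} {ops : List (Option ℕ)}
      (hx : x ∉ R) (hy : y ∈ R) (hxy : x < y) (hgap : ∀ r ∈ R, r ≤ x ∨ y ≤ r)
      (h : RowInsert (insert x (R.erase y)) u R' ops) :
      RowInsert R (x :: u) R' (some y :: ops)

namespace RowInsert

lemma exists_of_nodup (u : List ℕ) : ∀ R : Finset ℕ, u.Nodup → (∀ x ∈ u, x ∉ R) →
    ∃ R' ops, RowInsert R u R' ops := by
  induction u with
  | nil => exact fun R _ _ => ⟨R, [], .nil R⟩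
  | cons x u ih =>
    intro R hu hR
    rw [List.nodup_cons] at hu
    have hxR : x ∉ R := hR x (by simp)
    by_cases hbump : ∃ y ∈ R, x < y
    · obtain ⟨y, hy, hmin⟩ := (R.filter (x < ·)).exists_min_image id
        (by obtain ⟨y, hy⟩ := hbump; exact ⟨y, Finset.mem_filter.2 hy⟩)
      rw [Finset.mem_filter] at hy
      obtain ⟨R', ops, h⟩ := ih (insert x (R.erase y)) hu.2 (by grind)
      refine ⟨R', some y :: ops, .bump hxR hy.1 hy.2 (fun r hr => ?_) h⟩
      by_contra! hcon
      exact absurd (hmin r (Finset.mem_filter.2 ⟨hr, hcon.1⟩)) (by simpa using hcon.2)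
    · obtain ⟨R', ops, h⟩ := ih (insert x R) hu.2 (by grind)
      exact ⟨R', none :: ops, .append (by grind) h⟩

lemma unique {R R₁ R₂ : Finset ℕ} {u : List ℕ} {ops₁ ops₂ : List (Option ℕ)}
    (h₁ : RowInsert R u R₁ ops₁) (h₂ : RowInsert R u R₂ ops₂) : R₁ = R₂ ∧ ops₁ = ops₂ := by
  induction h₁ generalizing ops₂ with
  | nil R => cases h₂; exact ⟨rfl, rfl⟩
  | append hx _ ih =>
    cases h₂ with
    | append _ h =>
      obtain ⟨rfl, rfl⟩ := ih h
      exact ⟨rfl, rfl⟩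
    | bump _ hy hxy => exact absurd (hx _ hy) hxy.not_gt
  | @bump R R' x y u ops hx hy hxy hgap _ ih =>
    cases h₂ with
    | append hx' => exact absurd (hx' _ hy) hxy.not_gt
    | @bump _ _ _ y' _ _ _ hy' hxy' hgap' h =>
      obtain rfl : y = y' := by
        have h1 := hgap y' hy'
        have h2 := hgap' y hy
        omega
      obtain ⟨rfl, rfl⟩ := ih h
      exact ⟨rfl, rfl⟩

lemma unique_rev {R₁ R₂ R' : Finset ℕ} {u₁ u₂ : List ℕ} {ops : List (Option ℕ)}
    (h₁ : RowInsert R₁ u₁ R' ops) (h₂ : RowInsert R₂ u₂ R' ops) : R₁ = R₂ ∧ u₁ = u₂ := by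
  induction h₁ generalizing R₂ u₂ with
  | nil R => cases h₂; exact ⟨rfl, rfl⟩
  | @append R R' x u ops hx _ ih =>
    cases h₂ with
    | @append _ _ x' _ _ hx' h =>
      obtain ⟨hR, rfl⟩ := ih h
      have h1 : x ∈ insert x' R₂ := hR ▸ Finset.mem_insert_self x R
      have h2 : x' ∈ insert x R := hR.symm ▸ Finset.mem_insert_self x' R₂
      obtain rfl : x = x' := by grind
      refine ⟨?_, rfl⟩
      have h3 : x ∉ R := fun h => (hx x h).false
      have h4 : x ∉ R₂ := fun h => (hx' x h).false
      rw [← Finset.erase_insert h3, hR, Finset.erase_insert h4]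
  | @bump R R' x y u ops hx hy hxy hgap _ ih =>
    cases h₂ with
    | @bump _ _ x' _ _ _ hx' hy' hxy' hgap' h =>
      obtain ⟨hR, rfl⟩ := ih h
      have h1 : x ∈ insert x' (R₂.erase y) := hR ▸ Finset.mem_insert_self x _
      have h2 : x' ∈ insert x (R.erase y) := hR.symm ▸ Finset.mem_insert_self x' _
      obtain rfl : x = x' := by grind
      refine ⟨?_, rfl⟩
      have h3 : x ∉ R.erase y := fun h => hx (Finset.mem_of_mem_erase h)
      have h4 : x ∉ R₂.erase y := fun h => hx' (Finset.mem_of_mem_erase h)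
      rw [← Finset.insert_erase hy, ← Finset.insert_erase hy', ← Finset.erase_insert h3, hR,
        Finset.erase_insert h4]

variable {R R' : Finset ℕ} {u : List ℕ} {ops : List (Option ℕ)}

lemma val_add_eq (h : RowInsert R u R' ops) :
    R.val + (u : Multiset ℕ) = R'.val + (ops.reduceOption : Multiset ℕ) := by
  induction h with
  | nil R => simp
  | @append R R' x u ops hx _ ih =>
    have hxR : x ∉ R := fun h => (hx x h).false
    rw [Finset.insert_val_of_notMem hxR] at ih
    rw [List.reduceOption_cons_of_none, ← ih, ← Multiset.cons_coe, Multiset.add_cons,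
      Multiset.cons_add]
  | @bump R R' x y u ops hx hy hxy hgap _ ih =>
    have h3 : x ∉ R.erase y := fun h => hx (Finset.mem_of_mem_erase h)
    rw [Finset.insert_val_of_notMem h3, Finset.erase_val] at ih
    rw [List.reduceOption_cons_of_some, ← Multiset.cons_coe, ← Multiset.cons_coe,
      Multiset.add_cons, Multiset.add_cons, ← ih]
    conv_lhs => rw [← Multiset.cons_erase (show y ∈ R.val from hy)]
    simp [Multiset.cons_swap]

lemma length_eq (h : RowInsert R u R' ops) : ops.length = u.length := by
  induction h with
  | nil R => rfl
  | append _ _ ih => simp [ih]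
  | bump _ _ _ _ _ ih => simp [ih]

end RowInsert

/-- The subword of `u` formed by the letters `i` and `i + 1`. -/
def pairWord (i : ℕ) (u : List ℕ) : List ℕ := u.filter fun z => z = i ∨ z = i + 1

lemma pairWord_append (i : ℕ) (u v : List ℕ) :
    pairWord i (u ++ v) = pairWord i u ++ pairWord i v :=
  List.filter_append ..

/-- The subword formed by the letters `i` and `i + 1` of the increasing word of a set `R`. -/
def rowPairWord (i : ℕ) (R : Finset ℕ) : List ℕ :=
  (if i ∈ R then [i] else []) ++ if i + 1 ∈ R then [i + 1] else []

lemma RowInsert.pairWord_eq {R R' : Finset ℕ} {u : List ℕ} {ops : List (Option ℕ)}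
    (h : RowInsert R u R' ops) (i : ℕ) :
    rowPairWord i R ++ pairWord i u = pairWord i ops.reduceOption ++ rowPairWord i R' := by
  induction h with
  | nil R => simp [pairWord]
  | @append R R' x u ops hx _ ih =>
    rw [List.reduceOption_cons_of_none, ← ih, ← List.singleton_append, pairWord_append,
      ← List.append_assoc]
    congr 1
    have h1 : i ∈ R → i < x := hx i
    have h2 : i + 1 ∈ R → i + 1 < x := hx (i + 1)
    simp only [rowPairWord, pairWord, List.filter_singleton, Finset.mem_insert]
    grind
  | @bump R R' x y u ops hx hy hxy hgap _ ih =>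
    rw [List.reduceOption_cons_of_some, ← List.singleton_append,
      ← List.singleton_append (l := ops.reduceOption), pairWord_append, pairWord_append,
      List.append_assoc, ← ih, ← List.append_assoc, ← List.append_assoc]
    congr 1
    have h1 := hgap i
    have h2 := hgap (i + 1)
    simp only [rowPairWord, pairWord, List.filter_singleton, Finset.mem_insert, Finset.mem_erase]
    grind

/-- `R` records the ends of the longest increasing subwords of `w`: for every `x`, the longest
increasing subword of `w` with letters below `x` has as many letters as `R` has elements
below `x`. -/
def RowOf (w : List ℕ) (R : Finset ℕ) : Prop :=
  ∀ x j, (∃ l : List ℕ, l.Sublist w ∧ l.Pairwise (· < ·) ∧ (∀ z ∈ l, z < x) ∧ l.length = j) ↔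
    j ≤ (R.filter (· < x)).card

lemma RowOf.append_singleton {w : List ℕ} {R S : Finset ℕ} {z : ℕ} (h : RowOf w R)
    (hS : ∀ x, (S.filter (· < x)).card = if x ≤ z then (R.filter (· < x)).card
      else max (R.filter (· < x)).card ((R.filter (· < z)).card + 1)) :
    RowOf (w ++ [z]) S := by
  intro x j
  rw [hS]
  constructor
  · rintro ⟨l, hl, hinc, hlt, rfl⟩
    obtain ⟨l₁, l₂, rfl, h₁, h₂⟩ := List.sublist_append_iff.1 hl
    rw [List.pairwise_append] at hinc
    rcases List.sublist_singleton.1 h₂ with rfl | rfl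
    · have := (h x _).1 ⟨l₁, h₁, hinc.1, fun t ht => hlt t (by simp [ht]), rfl⟩
      rw [List.append_nil]
      split_ifs <;> omega
    · have hzx : z < x := hlt z (by simp)
      have := (h z _).1 ⟨l₁, h₁, hinc.1, fun t ht => hinc.2.2 t ht z (by simp), rfl⟩
      rw [if_neg (by omega), List.length_append, List.length_singleton]
      omega
  · intro hj
    by_cases hjx : j ≤ (R.filter (· < x)).card
    · obtain ⟨l, hl, hl'⟩ := (h x j).2 hjx
      exact ⟨l, hl.trans (List.sublist_append_left _ _), hl'⟩
    · have hxz : ¬ x ≤ z := fun hxz => hjx (by rwa [if_pos hxz] at hj)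
      rw [if_neg hxz] at hj
      have hzx : z < x := not_le.1 hxz
      obtain ⟨l, hl, hinc, hlt, hlen⟩ := (h z (j - 1)).2 (by omega)
      refine ⟨l ++ [z], hl.append_right _, ?_, ?_, ?_⟩
      · rw [List.pairwise_append]
        simpa [hinc] using hlt
      · intro t ht
        rcases List.mem_append.1 ht with ht | ht
        · exact (hlt t ht).trans hzx
        · rwa [List.mem_singleton.1 ht]
      · rw [List.length_append, List.length_singleton]
        omega

lemma RowInsert.rowOf {R R' : Finset ℕ} {u : List ℕ} {ops : List (Option ℕ)}
    (h : RowInsert R u R' ops) : ∀ w, RowOf w R → RowOf (w ++ u) R' := by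
  induction h with
  | nil R => simp
  | @append R R' x u ops hx _ ih =>
    intro w hw
    rw [List.append_cons]
    refine ih _ (hw.append_singleton fun t => ?_)
    have hxR : x ∉ R := fun h => (hx x h).false
    rw [Finset.filter_insert]
    have hlt : R.filter (· < x) = R := Finset.filter_true_of_mem hx
    by_cases ht : t ≤ x
    · rw [if_neg ht.not_gt, if_pos ht]
    · have hlt' : R.filter (· < t) = R :=
        Finset.filter_true_of_mem fun r hr => (hx r hr).trans (by omega)
      rw [if_pos (by omega), if_neg ht, hlt, hlt', Finset.card_insert_of_notMem hxR]
      omega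
  | @bump R R' x y u ops hx hy hxy hgap _ ih =>
    intro w hw
    rw [List.append_cons]
    refine ih _ (hw.append_singleton fun t => ?_)
    by_cases ht : t ≤ x
    · rw [if_pos ht]
      congr 1
      grind
    · rw [if_neg ht]
      by_cases hty : t ≤ y
      · have h1 : (insert x (R.erase y)).filter (· < t) = insert x (R.filter (· < x)) := by
          ext r
          have := hgap r
          simp only [Finset.mem_filter, Finset.mem_insert, Finset.mem_erase]
          grind
        have h2 : R.filter (· < t) = R.filter (· < x) := by
          ext r
          have := hgap r
          simp only [Finset.mem_filter]
          grind
        rw [h1, h2, Finset.card_insert_of_notMem (by simp)]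
        omega
      · have h1 : (insert x (R.erase y)).filter (· < t) =
            insert x ((R.filter (· < t)).erase y) := by
          ext r
          simp only [Finset.mem_filter, Finset.mem_insert, Finset.mem_erase]
          grind
        have h2 : insert y (R.filter (· < x)) ⊆ R.filter (· < t) := by
          intro r
          simp only [Finset.mem_filter, Finset.mem_insert]
          grind
        have h3 := Finset.card_le_card h2
        rw [Finset.card_insert_of_notMem (by simp [hxy.le])] at h3
        rw [h1, Finset.card_insert_of_notMem (by simp [hx]), Finset.card_erase_of_mem
          (by simp [hy]; omega)]
        omega

/-- Two rows share at least `p` of their smallest elements. -/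
def ShareInit (p : ℕ) (A C : Finset ℕ) : Prop :=
  ∃ S : Finset ℕ, S ⊆ A ∧ S ⊆ C ∧ (∀ a ∈ A, a ∉ S → ∀ s ∈ S, s < a) ∧
    (∀ c ∈ C, c ∉ S → ∀ s ∈ S, s < c) ∧ p ≤ S.card

lemma ShareInit.refl (A : Finset ℕ) : ShareInit A.card A A :=
  ⟨A, by grind, by grind, by grind, by grind, le_rfl⟩

lemma ShareInit.symm {p : ℕ} {A C : Finset ℕ} (h : ShareInit p A C) : ShareInit p C A := by
  obtain ⟨S, h1, h2, h3, h4, h5⟩ := h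
  exact ⟨S, h2, h1, h4, h3, h5⟩

lemma ShareInit.of_insert {p : ℕ} {A C : Finset ℕ} {x : ℕ} (hx : ∀ a ∈ A, a < x)
    (h : ShareInit p (insert x A) C) : ShareInit (p - 1) A C := by
  obtain ⟨S, h1, h2, h3, h4, h5⟩ := h
  refine ⟨S.erase x, by grind, by grind, by grind, ?_, ?_⟩
  · intro c hc hcS s hs
    rw [Finset.mem_erase] at hs
    by_cases hcx : c = x
    · subst hcx
      grind
    · grind
  · have := Finset.pred_card_le_card_erase (s := S) (a := x)
    omega

lemma ShareInit.exists_lt {p y : ℕ} {A C : Finset ℕ} (h : ShareInit p A C) (hp : 0 < p)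
    (hA : ∃ a ∈ A, a < y) : ∃ c ∈ C, c < y := by
  obtain ⟨S, h1, h2, h3, h4, h5⟩ := h
  obtain ⟨s, hs⟩ := Finset.card_pos.1 (hp.trans_le h5)
  obtain ⟨a, ha, hay⟩ := hA
  by_cases haS : a ∈ S
  · exact ⟨a, h2 haS, hay⟩
  · exact ⟨s, h2 hs, (h3 a ha haS s hs).trans hay⟩

lemma ShareInit.reverse_bump {p y a c : ℕ} {A C : Finset ℕ} (ha : a ∉ A) (hyA : y ∈ A)
    (hay : a < y) (hgapA : ∀ r ∈ A, r ≤ a ∨ y ≤ r) (hc : c ∉ C) (hyC : y ∈ C) (hcy : c < y)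
    (hgapC : ∀ r ∈ C, r ≤ c ∨ y ≤ r)
    (h : ShareInit p (insert a (A.erase y)) (insert c (C.erase y))) : ShareInit (p - 1) A C := by
  obtain ⟨S, h1, h2, h3, h4, h5⟩ := h
  by_cases haS : a ∈ S <;> by_cases hcS : c ∈ S
  · obtain rfl : a = c := by grind
    have hyS : y ∉ S := by grind
    refine ⟨insert y (S.erase a), by grind, by grind, by grind, by grind, ?_⟩
    rw [Finset.card_insert_of_notMem (by grind), Finset.card_erase_of_mem haS]
    omega
  · have hSc : ∀ s ∈ S, s < c := h4 c (by simp) hcS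
    have hSa : ∀ s ∈ S, s ≤ a := by grind
    refine ⟨S.erase a, by grind, by grind, by grind, by grind, ?_⟩
    rw [Finset.card_erase_of_mem haS]
    omega
  · have hSa : ∀ s ∈ S, s < a := h3 a (by simp) haS
    have hSc : ∀ s ∈ S, s ≤ c := by grind
    refine ⟨S.erase c, by grind, by grind, by grind, by grind, ?_⟩
    rw [Finset.card_erase_of_mem hcS]
    omega
  · exact ⟨S, by grind, by grind, by grind, by grind, by omega⟩

namespace RowInsert

lemma mem_or_mem {R R' : Finset ℕ} {u : List ℕ} {ops : List (Option ℕ)}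
    (h : RowInsert R u R' ops) {z : ℕ} (hz : z ∈ R) : z ∈ R' ∨ z ∈ ops.reduceOption := by
  have : z ∈ R.val + (u : Multiset ℕ) := Multiset.mem_add.2 (Or.inl hz)
  rw [h.val_add_eq] at this
  simpa using this

lemma exists_reverse_bump {A A' : Finset ℕ} {u : List ℕ} {ops : List (Option ℕ)} {y : ℕ}
    (h : RowInsert A u A' ops) (hy : y ∉ A) (hlt : ∃ a ∈ A, a < y) :
    ∃ a B, A = insert a (B.erase y) ∧ a ∉ B ∧ y ∈ B ∧ a < y ∧ (∀ r ∈ B, r ≤ a ∨ y ≤ r) ∧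
      RowInsert B (a :: u) A' (some y :: ops) := by
  obtain ⟨a, ha, hmax⟩ := (A.filter (· < y)).exists_max_image id
    (by obtain ⟨a, ha⟩ := hlt; exact ⟨a, Finset.mem_filter.2 ha⟩)
  rw [Finset.mem_filter] at ha
  have hA : A = insert a ((insert y (A.erase a)).erase y) := by grind
  have hgap : ∀ r ∈ insert y (A.erase a), r ≤ a ∨ y ≤ r := by
    intro r hr
    by_contra! hcon
    have := hmax r (by grind)
    simp only [id] at this
    omega
  refine ⟨a, insert y (A.erase a), hA, by grind, by grind, ha.2, hgap, ?_⟩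
  exact .bump (by grind) (by grind) ha.2 hgap (hA ▸ h)

/-- If a sequence of operations can be undone starting from `R'`, so can its bumps alone. -/
lemma exists_bumps {R R' : Finset ℕ} {u : List ℕ} {ops : List (Option ℕ)}
    (h : RowInsert R u R' ops) (hlen : ops.length ≤ R'.card) (hnd : ops.reduceOption.Nodup)
    (hdisj : ∀ z ∈ ops.reduceOption, z ∉ R') :
    ∃ C v, RowInsert C v R' (ops.reduceOption.map some) ∧ ShareInit (R'.card - ops.length) R C := by
  induction h with
  | nil R => exact ⟨R, [], .nil R, .refl R⟩
  | @append R R' x u ops hx h ih =>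
    rw [List.reduceOption_cons_of_none] at hnd hdisj ⊢
    rw [List.length_cons] at hlen
    obtain ⟨C, v, hC, hS⟩ := ih (by omega) hnd hdisj
    refine ⟨C, v, hC, ?_⟩
    rw [List.length_cons, Nat.sub_add_eq]
    exact hS.of_insert hx
  | @bump R R' x y u ops hx hy hxy hgap h ih =>
    rw [List.reduceOption_cons_of_some] at hnd hdisj ⊢
    rw [List.nodup_cons] at hnd
    rw [List.length_cons] at hlen
    obtain ⟨C', v, hC, hS⟩ := ih (by omega) hnd.2 (fun z hz => hdisj z (by simp [hz]))
    have hyC' : y ∉ C' := fun hmem => by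
      rcases hC.mem_or_mem hmem with h | h
      · exact hdisj y (by simp) h
      · rw [reduceOption_map_some] at h
        exact hnd.1 h
    obtain ⟨c, C, rfl, hc, hyC, hcy, hgapC, hC⟩ := hC.exists_reverse_bump hyC'
      (hS.exists_lt (by omega) ⟨x, by simp, hxy⟩)
    refine ⟨C, c :: v, hC, ?_⟩
    rw [List.length_cons, Nat.sub_add_eq]
    exact hS.reverse_bump hx hy hxy hgap hc hyC hcy hgapC

/-- If a sequence of bumps can be undone starting from `R'`, so can every sequence of operations
with these bumps whose length does not exceed the size of `R'`. -/
lemma exists_of_bumps (ops : List (Option ℕ)) : ∀ {C R' : Finset ℕ} {v : List ℕ},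
    RowInsert C v R' (ops.reduceOption.map some) → ops.length ≤ R'.card →
    ops.reduceOption.Nodup → (∀ z ∈ ops.reduceOption, z ∉ R') →
    ∃ R u, RowInsert R u R' ops ∧ ShareInit (R'.card - ops.length) R C ∧
      R'.card - ops.length ≤ R.card := by
  induction ops with
  | nil =>
    intro C R' v h _ _ _
    cases h
    exact ⟨C, [], .nil C, .refl C, by simp⟩
  | cons o ops ih =>
    intro C R' v h hlen hnd hdisj
    rw [List.length_cons] at hlen
    cases o with
    | none =>
      rw [List.reduceOption_cons_of_none] at h hnd hdisj
      obtain ⟨A, u, hA, hS, hcard⟩ := ih h (by omega) hnd hdisj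
      obtain ⟨x, hx, hmax⟩ := A.exists_max_image id (Finset.card_pos.1 (by omega))
      have hlt : ∀ r ∈ A.erase x, r < x := fun r hr =>
        lt_of_le_of_ne (hmax r (Finset.mem_of_mem_erase hr)) (Finset.ne_of_mem_erase hr)
      refine ⟨A.erase x, x :: u, .append hlt (by rwa [Finset.insert_erase hx]), ?_, ?_⟩
      · rw [List.length_cons, Nat.sub_add_eq]
        exact ShareInit.of_insert hlt (by rwa [Finset.insert_erase hx])
      · rw [List.length_cons, Finset.card_erase_of_mem hx]
        omega
    | some y =>
      rw [List.reduceOption_cons_of_some] at h hnd hdisj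
      rw [List.nodup_cons] at hnd
      cases h with
      | @bump _ _ c _ v _ hc hyC hcy hgapC hC =>
        obtain ⟨A, u, hA, hS, hcard⟩ := ih hC (by omega) hnd.2 (fun z hz => hdisj z (by simp [hz]))
        have hyA : y ∉ A := fun hmem => by
          rcases hA.mem_or_mem hmem with h | h
          · exact hdisj y (by simp) h
          · exact hnd.1 h
        obtain ⟨a, B, rfl, ha, hyB, hay, hgapB, hB⟩ := hA.exists_reverse_bump hyA
          (hS.symm.exists_lt (by omega) ⟨c, by simp, hcy⟩)
        refine ⟨B, a :: u, hB, ?_, ?_⟩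
        · rw [List.length_cons, Nat.sub_add_eq]
          exact hS.reverse_bump ha hyB hay hgapB hc hyC hcy hgapC
        · rw [Finset.card_insert_of_notMem (by grind), Finset.card_erase_of_mem hyB] at hcard
          rw [List.length_cons]
          omega

end RowInsert

/-- The words of length `k` with distinct letters in `{0, …, n - 1}`. -/
def words (n k : ℕ) : Finset (List ℕ) :=
  (Finset.powersetCard k (Finset.range n)).biUnion fun s => ⟨s.val.lists, Multiset.lists_nodup_finset s⟩

/-- The letters in `{0, …, n - 1}` missing from `u`. -/
def missing (n : ℕ) (u : List ℕ) : Finset ℕ := Finset.range n \ u.toFinset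

lemma mem_words {n k : ℕ} {u : List ℕ} :
    u ∈ words n k ↔ u.Nodup ∧ (∀ x ∈ u, x < n) ∧ u.length = k := by
  simp only [words, Finset.mem_biUnion, Finset.mem_powersetCard, Finset.mem_mk,
    Multiset.mem_lists_iff]
  constructor
  · rintro ⟨s, ⟨hs, rfl⟩, h⟩
    have h : s.val = (u : Multiset ℕ) := h
    refine ⟨Multiset.coe_nodup.1 (h ▸ s.nodup), fun x hx => ?_, ?_⟩
    · have : x ∈ s.val := by rw [h]; exact hx
      exact Finset.mem_range.1 (hs this)
    · rw [Finset.card, h, Multiset.coe_card]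
  · rintro ⟨hnd, hlt, rfl⟩
    exact ⟨⟨u, hnd⟩, ⟨fun x hx => Finset.mem_range.2 (hlt x hx), rfl⟩, rfl⟩

lemma val_add_eq_range_iff {n : ℕ} {R : Finset ℕ} {u : List ℕ} :
    R.val + (u : Multiset ℕ) = (Finset.range n).val ↔
      u.Nodup ∧ (∀ x ∈ u, x < n) ∧ R = missing n u := by
  constructor
  · intro h
    have hnd : (R.val + (u : Multiset ℕ)).Nodup := h ▸ (Finset.range n).nodup
    rw [Multiset.nodup_add] at hnd
    have hmem : ∀ x, x ∈ R ∨ x ∈ u ↔ x < n := by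
      intro x
      have : x ∈ R.val + (u : Multiset ℕ) ↔ x ∈ (Finset.range n).val := by rw [h]
      simpa using this
    have hdisj : ∀ x ∈ R, x ∉ u := by
      intro x hx hu
      exact (Multiset.disjoint_left.1 hnd.2.2) hx (by simpa using hu)
    refine ⟨by simpa using hnd.2.1, fun x hx => (hmem x).1 (Or.inr hx), ?_⟩
    ext x
    have h1 := hmem x
    have h2 := hdisj x
    simp only [missing, Finset.mem_sdiff, Finset.mem_range, List.mem_toFinset]
    tauto
  · rintro ⟨hnd, hlt, rfl⟩
    refine (Multiset.Nodup.ext ?_ (Finset.range n).nodup).2 fun x => ?_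
    · rw [Multiset.nodup_add]
      refine ⟨Finset.nodup _, by simpa using hnd, Multiset.disjoint_left.2 fun {x} hx hu => ?_⟩
      have hx : x ∈ missing n u := hx
      simp only [missing, Finset.mem_sdiff, Finset.mem_range, List.mem_toFinset] at hx
      exact hx.2 (by simpa using hu)
    · have := hlt x
      simp only [Multiset.mem_add, Finset.mem_val, missing, Finset.mem_sdiff, Finset.mem_range,
        List.mem_toFinset, Multiset.mem_coe]
      tauto

lemma card_missing {n k : ℕ} {u : List ℕ} (hu : u ∈ words n k) : (missing n u).card = n - k := by
  rw [mem_words] at hu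
  rw [missing, Finset.card_sdiff_of_subset, Finset.card_range, List.toFinset_card_of_nodup hu.1,
    hu.2.2]
  intro x hx
  simpa using hu.2.1 x (by simpa using hx)

/-- The record of the row insertion of `u` into the row of its missing letters. -/
noncomputable def insertOps (n : ℕ) (u : List ℕ) : List (Option ℕ) :=
  Classical.epsilon fun ops => ∃ R', RowInsert (missing n u) u R' ops

lemma rowInsert_insertOps {n k : ℕ} {u : List ℕ} (hu : u ∈ words n k) :
    RowInsert (missing n u) u (missing n (insertOps n u).reduceOption) (insertOps n u) ∧
      (insertOps n u).length = k ∧ (insertOps n u).reduceOption.Nodup ∧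
      ∀ x ∈ (insertOps n u).reduceOption, x < n := by
  rw [mem_words] at hu
  have hex : ∃ ops R', RowInsert (missing n u) u R' ops := by
    obtain ⟨R', ops, h⟩ := RowInsert.exists_of_nodup u (missing n u) hu.1
      (fun x hx => by simp [missing, hx])
    exact ⟨ops, R', h⟩
  obtain ⟨R', h⟩ := Classical.epsilon_spec hex
  have h' : RowInsert (missing n u) u R' (insertOps n u) := h
  have hval := h'.val_add_eq
  rw [val_add_eq_range_iff.2 ⟨hu.1, hu.2.1, rfl⟩, eq_comm, val_add_eq_range_iff] at hval
  obtain ⟨h1, h2, rfl⟩ := hval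
  exact ⟨h', h'.length_eq.trans hu.2.2, h1, h2⟩

/-- The positions of the letters of `u` that are appended to the row. -/
noncomputable def appendPositions (n k : ℕ) (u : List ℕ) : Finset ℕ :=
  (Finset.range k).filter fun j => (insertOps n u)[j]? = some none

lemma filter_getElem?_eq_iff {k : ℕ} {ops : List (Option ℕ)} (hk : ops.length = k)
    {s : Finset ℕ} (hs : s ⊆ Finset.range k) :
    (Finset.range k).filter (fun j => ops[j]? = some none) = s ↔
      ops.map Option.isSome = (List.range k).map fun j => decide (j ∉ s) := by
  subst hk
  constructor
  · intro h
    rw [← h]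
    refine List.ext_getElem (by simp) fun i h1 h2 => ?_
    have : i < ops.length := by simpa using h1
    simp only [List.getElem_map, List.getElem_range, Finset.mem_filter, Finset.mem_range,
      List.getElem?_eq_getElem this]
    cases ops[i] <;> simp [this]
  · intro h
    ext i
    rw [Finset.mem_filter, Finset.mem_range]
    by_cases hi : i < ops.length
    · have := congrArg (fun l => l[i]?) h
      simp only [List.getElem?_map, List.getElem?_eq_getElem hi, List.getElem?_range hi,
        Option.map_some, Option.some.injEq] at this
      rw [List.getElem?_eq_getElem hi]
      cases hop : ops[i] <;> simp_all
    · have : i ∉ s := fun h => hi (by simpa using hs h)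
      simp [hi, this]

lemma exists_ops {α : Type*} (T : List Bool) : ∀ B : List α, B.length = T.count true →
    ∃ ops : List (Option α), ops.map Option.isSome = T ∧ ops.reduceOption = B := by
  induction T with
  | nil => intro B hB; exact ⟨[], rfl, by simpa using hB⟩
  | cons b T ih =>
    intro B hB
    cases b with
    | false =>
      obtain ⟨ops, h1, h2⟩ := ih B (by simpa using hB)
      exact ⟨none :: ops, by simp [h1], by rw [List.reduceOption_cons_of_none, h2]⟩
    | true =>
      cases B with
      | nil => simp at hB
      | cons x B =>
        obtain ⟨ops, h1, h2⟩ := ih B (by simpa using hB)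
        exact ⟨some x :: ops, by simp [h1], by rw [List.reduceOption_cons_of_some, h2]⟩

lemma ext_of_isSome_of_reduceOption {α : Type*} {ops₁ : List (Option α)} :
    ∀ {ops₂ : List (Option α)}, ops₁.map Option.isSome = ops₂.map Option.isSome →
      ops₁.reduceOption = ops₂.reduceOption → ops₁ = ops₂ := by
  induction ops₁ with
  | nil => intro ops₂ h _; simpa using h.symm
  | cons o ops₁ ih =>
    intro ops₂ h h'
    cases ops₂ with
    | nil => simp at h
    | cons o' ops₂ =>
      rw [List.map_cons, List.map_cons, List.cons.injEq] at h
      cases o <;> cases o' <;> simp at h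
      · rw [List.reduceOption_cons_of_none, List.reduceOption_cons_of_none] at h'
        rw [ih (by simpa using h) h']
      · rw [List.reduceOption_cons_of_some, List.reduceOption_cons_of_some, List.cons.injEq] at h'
        rw [ih (by simpa using h) h'.2, h'.1]

lemma count_map_notMem {k : ℕ} {s : Finset ℕ} (hs : s ⊆ Finset.range k) :
    ((List.range k).map fun j => decide (j ∉ s)).count true = k - s.card := by
  have h : (Finset.range k \ s).card = k - s.card := by
    rw [Finset.card_sdiff_of_subset hs, Finset.card_range]
  rw [← h, List.count, List.countP_map, List.countP_eq_length_filter, Finset.sdiff_eq_filter,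
    ← List.toFinset_card_of_nodup (List.nodup_range.filter _)]
  congr 1
  ext j
  simp

lemma length_reduceOption_eq_count {α : Type*} (ops : List (Option α)) :
    ops.reduceOption.length = (ops.map Option.isSome).count true := by
  rw [List.reduceOption_length_eq, List.count, List.countP_map, List.countP_eq_length_filter]
  congr 2
  ext o
  simp

/-- The inverse major index of the permutation whose word is the increasing word of the
letters missing from `u`, followed by `u`. -/
def majAfterRow (n : ℕ) (u : List ℕ) : ℕ :=
  ∑ i ∈ Finset.range n,
    if rowPairWord i (missing n u) ++ pairWord i u = [i + 1, i] then i + 1 else 0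

/-- The inverse major index of the permutation whose word is `B`, followed by the increasing
word of the letters missing from `B`. -/
def majBeforeRow (n : ℕ) (B : List ℕ) : ℕ :=
  ∑ i ∈ Finset.range n,
    if pairWord i B ++ rowPairWord i (missing n B) = [i + 1, i] then i + 1 else 0

/-- The words of length `m` that occur as the sequence of bumped entries of a sequence of
`m` insertions. -/
noncomputable def bumpWords (n m : ℕ) : Finset (List ℕ) :=
  @Finset.filter _ (fun B => ∃ R u, RowInsert R u (missing n B) (B.map some))
    (Classical.decPred _) (words n m)

lemma mem_bumpWords {n m : ℕ} {B : List ℕ} :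
    B ∈ bumpWords n m ↔ B ∈ words n m ∧ ∃ R u, RowInsert R u (missing n B) (B.map some) := by
  simp [bumpWords]

lemma sum_appendPositions_eq {n k : ℕ} {s : Finset ℕ} (hs : s ⊆ Finset.range k)
    (hk : k + (k - s.card) ≤ n) :
    ∑ u ∈ (words n k).filter (fun u => appendPositions n k u = s),
        (X : Polynomial ℤ) ^ majAfterRow n u =
      ∑ B ∈ bumpWords n (k - s.card), X ^ majBeforeRow n B := by
  have hpat : ∀ u ∈ words n k, appendPositions n k u = s ↔ (insertOps n u).map Option.isSome =
      (List.range k).map fun j => decide (j ∉ s) := fun u hu =>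
    filter_getElem?_eq_iff (rowInsert_insertOps hu).2.1 hs
  refine Finset.sum_bij (fun u _ => (insertOps n u).reduceOption) ?_ ?_ ?_ ?_
  · intro u hu
    rw [Finset.mem_filter] at hu
    obtain ⟨h1, h2, h3, h4⟩ := rowInsert_insertOps hu.1
    have hmem : (insertOps n u).reduceOption ∈ words n (k - s.card) :=
      mem_words.2 ⟨h3, h4, by
        rw [length_reduceOption_eq_count, (hpat u hu.1).1 hu.2, count_map_notMem hs]⟩
    rw [mem_bumpWords]
    refine ⟨hmem, ?_⟩
    obtain ⟨C, v, hC, -⟩ := h1.exists_bumps (by rw [card_missing hmem]; omega) h3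
      (fun z hz => by simp [missing, hz])
    exact ⟨C, v, hC⟩
  · intro u hu v hv huv
    rw [Finset.mem_filter] at hu hv
    have huv : (insertOps n u).reduceOption = (insertOps n v).reduceOption := huv
    have hops : insertOps n u = insertOps n v := ext_of_isSome_of_reduceOption
      (((hpat u hu.1).1 hu.2).trans ((hpat v hv.1).1 hv.2).symm) huv
    have h1 := (rowInsert_insertOps hu.1).1
    rw [hops] at h1
    exact (h1.unique_rev (rowInsert_insertOps hv.1).1).2
  · intro B hB
    rw [mem_bumpWords] at hB
    obtain ⟨hB, R, u, h⟩ := hB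
    have hcard := card_missing hB
    rw [mem_words] at hB
    obtain ⟨ops, h1, rfl⟩ := exists_ops ((List.range k).map fun j => decide (j ∉ s))
      B (by rw [hB.2.2, count_map_notMem hs])
    have hlen : ops.length = k := by simpa using congrArg List.length h1
    obtain ⟨A, v, hA, -⟩ := RowInsert.exists_of_bumps ops h (by rw [hcard]; omega) hB.1
      (fun z hz => by simp [missing, hz])
    have hval := hA.val_add_eq
    rw [val_add_eq_range_iff.2 ⟨hB.1, hB.2.1, rfl⟩, val_add_eq_range_iff] at hval
    obtain ⟨h3, h4, rfl⟩ := hval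
    have hv : v ∈ words n k := mem_words.2 ⟨h3, h4, by rw [← hA.length_eq, hlen]⟩
    have hops := ((rowInsert_insertOps hv).1.unique hA).2
    exact ⟨v, Finset.mem_filter.2 ⟨hv, (hpat v hv).2 (hops ▸ h1)⟩, by rw [hops]⟩
  · intro u hu
    rw [Finset.mem_filter] at hu
    obtain ⟨h1, -⟩ := rowInsert_insertOps hu.1
    simp only [majAfterRow, majBeforeRow, h1.pairWord_eq]

lemma sum_words {n k : ℕ} (h : 2 * k ≤ n) :
    ∑ u ∈ words n k, (X : Polynomial ℤ) ^ majAfterRow n u =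
      ∑ s ∈ Finset.range (k + 1), (k.choose s : Polynomial ℤ) *
        ∑ u ∈ (words n (k - s)).filter (fun u => appendPositions n (k - s) u = ∅),
          X ^ majAfterRow n u := by
  rw [← Finset.sum_fiberwise_of_maps_to (s := words n k) (t := (Finset.range k).powerset)
    (g := appendPositions n k) (fun u _ => Finset.mem_powerset.2 (Finset.filter_subset _ _))]
  rw [Finset.sum_congr rfl fun s hs =>
    sum_appendPositions_eq (n := n) (Finset.mem_powerset.1 hs) (by omega)]
  rw [Finset.sum_powerset_apply_card
    (fun m => ∑ B ∈ bumpWords n (k - m), (X : Polynomial ℤ) ^ majBeforeRow n B),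
    Finset.card_range]
  refine Finset.sum_congr rfl fun s _ => ?_
  rw [sum_appendPositions_eq (Finset.empty_subset _) (by simp; omega), nsmul_eq_mul,
    Finset.card_empty, Nat.sub_zero]

/-- The word of a permutation, as a list of natural numbers. -/
def permWord {n : ℕ} (w : Equiv.Perm (Fin n)) : List ℕ := List.ofFn fun i => (w i : ℕ)

/-- The last `k` letters of the word of a permutation. -/
def suffixWord {n : ℕ} (k : ℕ) (w : Equiv.Perm (Fin n)) : List ℕ := (permWord w).drop (n - k)

lemma length_permWord {n : ℕ} (w : Equiv.Perm (Fin n)) : (permWord w).length = n := by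
  simp [permWord]

lemma nodup_permWord {n : ℕ} (w : Equiv.Perm (Fin n)) : (permWord w).Nodup :=
  List.nodup_ofFn.2 (Fin.val_injective.comp w.injective)

lemma mem_permWord {n : ℕ} (w : Equiv.Perm (Fin n)) (x : ℕ) : x ∈ permWord w ↔ x < n := by
  rw [permWord, List.mem_ofFn]
  constructor
  · rintro ⟨i, rfl⟩
    exact (w i).isLt
  · intro hx
    exact ⟨w⁻¹ ⟨x, hx⟩, by simp⟩

lemma permWord_injective {n : ℕ} : Function.Injective (permWord (n := n)) := fun _ _ h =>
  Equiv.ext fun i => Fin.ext (congrFun (List.ofFn_injective h) i)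

lemma suffixWord_mem_words {n k : ℕ} (hk : k ≤ n) (w : Equiv.Perm (Fin n)) :
    suffixWord k w ∈ words n k := by
  refine mem_words.2 ⟨(nodup_permWord w).sublist (List.drop_sublist _ _), fun x hx => ?_, ?_⟩
  · exact (mem_permWord w x).1 (List.mem_of_mem_drop hx)
  · rw [suffixWord, List.length_drop, length_permWord]
    omega

lemma pairwise_take_permWord_iff {n k : ℕ} (w : Equiv.Perm (Fin n)) :
    ((permWord w).take (n - k)).Pairwise (· < ·) ↔ PrefixInc n k w := by
  rw [List.pairwise_iff_getElem]
  simp only [permWord, List.length_take, List.length_ofFn, List.getElem_take, List.getElem_ofFn]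
  constructor
  · intro h i j hij hj
    exact h i j (by omega) (by omega) hij
  · intro h i j hi hj hij
    exact h ⟨i, by omega⟩ ⟨j, by omega⟩ hij (by simp; omega)

lemma permWord_eq {n k : ℕ} {w : Equiv.Perm (Fin n)} (hw : PrefixInc n k w) :
    permWord w = (missing n (suffixWord k w)).sort ++ suffixWord k w := by
  have hnd := nodup_permWord w
  have hmem := mem_permWord w
  rw [← List.take_append_drop (n - k) (permWord w)] at hnd hmem
  rw [List.nodup_append] at hnd
  have hset : missing n (suffixWord k w) = ((permWord w).take (n - k)).toFinset := by
    ext x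
    have h1 := hmem x
    have h2 := hnd.2.2 x
    simp only [missing, Finset.mem_sdiff, Finset.mem_range, List.mem_toFinset, ← h1,
      List.mem_append, suffixWord]
    grind
  have hsort : (missing n (suffixWord k w)).sort = (permWord w).take (n - k) := by
    rw [hset, List.toFinset_sort (· ≤ ·) hnd.1]
    exact ((pairwise_take_permWord_iff w).2 hw).imp le_of_lt
  rw [hsort, suffixWord, List.take_append_drop]

lemma exists_permWord_eq {n : ℕ} {l : List ℕ} (hlen : l.length = n) (hnd : l.Nodup)
    (hlt : ∀ x ∈ l, x < n) : ∃ w : Equiv.Perm (Fin n), permWord w = l := by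
  subst hlen
  let f : Fin l.length → Fin l.length := fun i => ⟨l[i], hlt _ (List.getElem_mem _)⟩
  have hf : Function.Injective f := fun i j hij => by
    have : l[i] = l[j] := congrArg Fin.val hij
    exact Fin.ext ((hnd.getElem_inj_iff).1 this)
  refine ⟨Equiv.ofBijective f (Finite.injective_iff_bijective.1 hf), ?_⟩
  refine List.ext_getElem (by simp [permWord]) fun i h1 h2 => ?_
  simp [permWord, f]

lemma exists_suffixWord_eq {n k : ℕ} {u : List ℕ} (hu : u ∈ words n k) :
    ∃ w : Equiv.Perm (Fin n), PrefixInc n k w ∧ suffixWord k w = u := by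
  have hcard := card_missing hu
  rw [mem_words] at hu
  obtain ⟨hnd, hlt, hlen⟩ := hu
  have hk : k ≤ n := by
    have := Finset.card_le_card (show u.toFinset ⊆ Finset.range n from
      fun x hx => Finset.mem_range.2 (hlt x (by simpa using hx)))
    rwa [List.toFinset_card_of_nodup hnd, hlen, Finset.card_range] at this
  have hsort : (missing n u).sort.length = n - k := by rw [Finset.length_sort, hcard]
  obtain ⟨w, hw⟩ := exists_permWord_eq (n := n) (l := (missing n u).sort ++ u)
    (by rw [List.length_append, hsort]; omega)
    (by
      rw [List.nodup_append]
      refine ⟨Finset.sort_nodup _ _, hnd, ?_⟩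
      rintro a ha b hb rfl
      rw [Finset.mem_sort] at ha
      simp [missing, hb] at ha)
    (by
      intro x hx
      rcases List.mem_append.1 hx with h | h
      · rw [Finset.mem_sort] at h
        simp only [missing, Finset.mem_sdiff, Finset.mem_range] at h
        exact h.1
      · exact hlt x h)
  refine ⟨w, ?_, ?_⟩
  · rw [← pairwise_take_permWord_iff, hw, List.take_left' hsort]
    exact (Finset.sortedLT_sort _).pairwise
  · rw [suffixWord, hw, List.drop_left' hsort]

lemma pairWord_sort (i : ℕ) (R : Finset ℕ) : pairWord i R.sort = rowPairWord i R := by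
  have h1 : (rowPairWord i R).Pairwise (· < ·) := by
    rw [rowPairWord]
    split_ifs <;> simp
  have h2 : (pairWord i R.sort).toFinset = (rowPairWord i R).toFinset := by
    ext z
    simp only [pairWord, rowPairWord, List.mem_toFinset, List.mem_filter, Finset.mem_sort,
      List.mem_append]
    grind
  rw [← List.toFinset_sort (· ≤ ·) (h1.imp ne_of_lt) |>.2 (h1.imp le_of_lt), ← h2]
  refine (List.toFinset_sort (· ≤ ·) ((Finset.sort_nodup _ _).filter _) |>.2 ?_).symm
  exact (Finset.pairwise_sort R _).filter _

lemma pairWord_permWord_iff {n i : ℕ} (w : Equiv.Perm (Fin n)) (h : i + 1 < n) :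
    pairWord i (permWord w) = [i + 1, i] ↔
      w⁻¹ ⟨i + 1, h⟩ < w⁻¹ ⟨i, Nat.lt_of_succ_lt h⟩ := by
  have hpair : (permWord w).Pairwise fun a b => ∀ ha hb, w⁻¹ ⟨a, ha⟩ < w⁻¹ ⟨b, hb⟩ := by
    rw [permWord, List.pairwise_ofFn]
    intro a b hab _ _
    simpa using hab
  rw [List.pairwise_iff_forall_sublist] at hpair
  have hsub : (pairWord i (permWord w)).Sublist (permWord w) := List.filter_sublist
  constructor
  · intro heq
    exact hpair (heq ▸ hsub) _ _
  · intro hlt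
    have hnd : (pairWord i (permWord w)).Nodup := (nodup_permWord w).sublist hsub
    have hmem : ∀ z, z ∈ pairWord i (permWord w) ↔ z = i ∨ z = i + 1 := by
      intro z
      simp only [pairWord, List.mem_filter, mem_permWord, decide_eq_true_eq]
      omega
    have hperm : (pairWord i (permWord w)).Perm [i + 1, i] := by
      rw [List.perm_ext_iff_of_nodup hnd (by simp)]
      intro z
      rw [hmem]
      simp [or_comm]
    have hlen := hperm.length_eq
    generalize pairWord i (permWord w) = l at *
    match l, hlen with
    | [a, b], _ =>
      have ha := (hmem a).1 (by simp)
      have hb := (hmem b).1 (by simp)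
      simp only [List.nodup_cons, List.mem_singleton] at hnd
      have hab := hnd.1
      rcases ha with rfl | rfl
      · obtain rfl : b = a + 1 := by omega
        exact absurd (hpair hsub (by omega) (by omega)) hlt.not_gt
      · obtain rfl : b = i := by omega
        rfl

lemma maj_inv_eq {n k : ℕ} {w : Equiv.Perm (Fin n)} (hw : PrefixInc n k w) :
    maj w⁻¹ = majAfterRow n (suffixWord k w) := by
  refine Finset.sum_congr rfl fun i _ => ?_
  rw [← pairWord_sort, ← pairWord_append, ← permWord_eq hw]
  by_cases h : i + 1 < n
  · rw [dif_pos h]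
    simp only [pairWord_permWord_iff w h]
  · rw [dif_neg h, if_neg]
    intro heq
    have : i + 1 ∈ pairWord i (permWord w) := by simp [heq]
    exact h ((mem_permWord w _).1 (List.mem_of_mem_filter this))

lemma rowOf_sort (R : Finset ℕ) : RowOf R.sort R := by
  intro x j
  constructor
  · rintro ⟨l, hl, hinc, hlt, rfl⟩
    rw [← List.toFinset_card_of_nodup (hinc.imp ne_of_lt)]
    refine Finset.card_le_card fun z hz => ?_
    rw [List.mem_toFinset] at hz
    exact Finset.mem_filter.2 ⟨(Finset.mem_sort _).1 (hl.subset hz), hlt z hz⟩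
  · intro hj
    have hsub : ((R.filter (· < x)).sort.take j).Sublist (R.filter (· < x)).sort :=
      List.take_sublist _ _
    have hfil : (R.filter (· < x)).sort = R.sort.filter (· < x) := by
      have := (List.toFinset_sort (· ≤ ·) ((Finset.sort_nodup R (· ≤ ·)).filter (· < x))).2
        ((Finset.pairwise_sort R _).filter _)
      rw [← this]
      congr 1
      ext z
      simp
    refine ⟨_, hsub.trans (hfil ▸ List.filter_sublist),
      (Finset.sortedLT_sort _).pairwise.sublist hsub, fun z hz => ?_, ?_⟩
    · have := hsub.subset hz
      rw [Finset.mem_sort, Finset.mem_filter] at this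
      exact this.2
    · rw [List.length_take, Finset.length_sort]
      omega

lemma hasIncSubseq_iff {n m : ℕ} (w : Equiv.Perm (Fin n)) :
    HasIncSubseq w m ↔
      ∃ l : List ℕ, l.Sublist (permWord w) ∧ l.Pairwise (· < ·) ∧ (∀ z ∈ l, z < n) ∧
        l.length = m := by
  constructor
  · rintro ⟨f, hf, hinc⟩
    refine ⟨List.ofFn fun j => (w (f j) : ℕ), ?_, ?_, ?_, by simp⟩
    · rw [List.sublist_iff_exists_fin_orderEmbedding_get_eq]
      refine ⟨OrderEmbedding.ofStrictMono
        (fun j => Fin.cast (length_permWord w).symm (f (Fin.cast (by simp) j))) ?_, ?_⟩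
      · intro a b hab
        exact hf hab
      · intro j
        simp [permWord]
        rfl
    · rw [List.pairwise_ofFn]
      exact fun a b hab => hinc hab
    · intro z hz
      obtain ⟨j, rfl⟩ := List.mem_ofFn.1 hz
      exact (w (f j)).isLt
  · rintro ⟨l, hl, hinc, -, rfl⟩
    obtain ⟨f, hf⟩ := List.sublist_iff_exists_fin_orderEmbedding_get_eq.1 hl
    refine ⟨fun j => Fin.cast (length_permWord w) (f j), fun a b hab => f.strictMono hab, ?_⟩
    have hval : ∀ j, (w (Fin.cast (length_permWord w) (f j)) : ℕ) = l.get j := by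
      intro j
      rw [hf j]
      simp [permWord]
      rfl
    intro a b hab
    rw [Fin.lt_def, hval, hval]
    exact List.pairwise_iff_get.1 hinc a b hab

lemma isLen_eq {n k : ℕ} (hk : k ≤ n) {w : Equiv.Perm (Fin n)} (hw : PrefixInc n k w) :
    isLen w = n - (insertOps n (suffixWord k w)).reduceOption.length := by
  obtain ⟨h1, -, h2, h3⟩ := rowInsert_insertOps (suffixWord_mem_words hk w)
  have hrow := h1.rowOf _ (rowOf_sort _)
  rw [← permWord_eq hw] at hrow
  have hcard := card_missing (mem_words.2 ⟨h2, h3, rfl⟩)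
  have hset : {m | HasIncSubseq w m} =
      Set.Iic (n - (insertOps n (suffixWord k w)).reduceOption.length) := by
    ext m
    rw [Set.mem_ofPred_eq, hasIncSubseq_iff, hrow, Set.mem_Iic, ← hcard, Finset.filter_true_of_mem]
    intro z hz
    simp only [missing, Finset.mem_sdiff, Finset.mem_range] at hz
    exact hz.1
  rw [isLen, hset, csSup_Iic]

lemma isLen_eq_sub_iff {n k : ℕ} (hk : k ≤ n) {w : Equiv.Perm (Fin n)} (hw : PrefixInc n k w) :
    isLen w = n - k ↔ appendPositions n k (suffixWord k w) = ∅ := by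
  obtain ⟨-, hlen, -⟩ := rowInsert_insertOps (suffixWord_mem_words hk w)
  have hle := List.reduceOption_length_le (insertOps n (suffixWord k w))
  rw [isLen_eq hk hw, appendPositions, Finset.filter_eq_empty_iff]
  have : n - (insertOps n (suffixWord k w)).reduceOption.length = n - k ↔
      ¬ (insertOps n (suffixWord k w)).reduceOption.length <
        (insertOps n (suffixWord k w)).length := by omega
  rw [this, List.reduceOption_length_lt_iff, List.mem_iff_getElem?]
  constructor
  · exact fun h j _ hj => h ⟨j, hj⟩
  · rintro h ⟨j, hj⟩
    obtain ⟨hj', -⟩ := List.getElem?_eq_some_iff.1 hj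
    exact h (Finset.mem_range.2 (hlen ▸ hj')) hj

/-- Permutations with increasing prefix are determined by their suffixes. -/
lemma sum_eq_sum_words {n k : ℕ} {A : Finset (Equiv.Perm (Fin n))}
    {U : Finset (List ℕ)} (hU : U ⊆ words n k)
    (hA : ∀ w, w ∈ A ↔ PrefixInc n k w ∧ suffixWord k w ∈ U) :
    ∑ w ∈ A, (X : Polynomial ℤ) ^ maj w⁻¹ = ∑ u ∈ U, X ^ majAfterRow n u := by
  refine Finset.sum_bij (fun w _ => suffixWord k w) (fun w hw => ((hA w).1 hw).2) ?_ ?_ ?_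
  · intro w hw w' hw' h
    have h : suffixWord k w = suffixWord k w' := h
    apply permWord_injective
    rw [permWord_eq ((hA w).1 hw).1, permWord_eq ((hA w').1 hw').1, h]
  · intro u hu
    obtain ⟨w, hw, rfl⟩ := exists_suffixWord_eq (hU hu)
    exact ⟨w, (hA w).2 ⟨hw, hu⟩, rfl⟩
  · intro w hw
    rw [maj_inv_eq ((hA w).1 hw).1]

/-- For `n >= 2k`, the binomially weighted sum over `s` of the generating functions of
`maj(w⁻¹)` over `Pi_{n,k-s}` equals `[n]_q [n-1]_q ⋯ [n-k+1]_q`. -/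
theorem pi_recurrence_q (n k : ℕ) (h : 2 * k ≤ n) :
    ∑ s ∈ Finset.range (k + 1),
        (k.choose s : Polynomial ℤ) *
          ∑ w ∈ PiFinset n (k - s), (X : Polynomial ℤ) ^ maj w⁻¹ =
      ∏ j ∈ Finset.range k, qInt (n - j) := by
  have hC : ∑ w ∈ CFinset n k, (X : Polynomial ℤ) ^ maj w⁻¹ =
      ∑ u ∈ words n k, X ^ majAfterRow n u :=
    sum_eq_sum_words subset_rfl fun w => by
      simp [CFinset, suffixWord_mem_words (show k ≤ n by omega) w]
  rw [← sum_CFinset k n (by omega), hC, sum_words h]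
  refine Finset.sum_congr rfl fun s _ => ?_
  congr 1
  refine sum_eq_sum_words (Finset.filter_subset _ _) fun w => ?_
  have hk : k - s ≤ n := by omega
  simp only [PiFinset, Finset.mem_filter, Finset.mem_univ, true_and, suffixWord_mem_words hk w]
  exact and_congr_right fun hw => isLen_eq_sub_iff hk hw
end

section
/- Let n, s be positive integers with n ≥ 2s, and let a ∈ {n−s+1, …, n}. Then there exists a bijection φ from C_{n,s,a} onto the set C_{n,s−1} \ (⋃_{b = n−s+2}^{a} C_{n,s−1,b}), i.e. onto the set of permutations w ∈ C_{n,s−1} such that the prefix w(1),…,w(a) contains no increasing subsequence of length n−s+2. Moreover φ preserves the inverse descent set: for every π ∈ C_{n,s,a} and every i ∈ {1,…,n−1}, one has π⁻¹(i+1) < π⁻¹(i) if and only if φ(π)⁻¹(i+1) < φ(π)⁻¹(i). -/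
open Polynomial

lemma pair_sublist_cons_iff {β : Type*} {x y z : β} {l : List β} :
    [x, y].Sublist (z :: l) ↔ [x, y].Sublist l ∨ (x = z ∧ y ∈ l) := by
  rw [List.cons_sublist_cons', List.singleton_sublist]

section FirstRow

variable {α : Type*} [LinearOrder α]

/-- The first row of the insertion tableau of the word whose letters, last letter first, are the
entries of the list. -/
def firstRow : List α → Finset α
  | [] => ∅
  | x :: l =>
    if h : ((firstRow l).filter (x < ·)).Nonempty then
      insert x ((firstRow l).erase (((firstRow l).filter (x < ·)).min' h))
    else insert x (firstRow l)

/-- The letters bumped out of the first row while inserting the word whose letters, last letter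
first, are the entries of the list; the letter bumped last comes first. -/
def bumped : List α → List α
  | [] => []
  | x :: l =>
    if h : ((firstRow l).filter (x < ·)).Nonempty then
      ((firstRow l).filter (x < ·)).min' h :: bumped l
    else bumped l

/-- Inserting a letter either appends it to the first row or bumps the least larger entry. -/
lemma firstRow_cons (x : α) (l : List α) :
    ((∀ r ∈ firstRow l, r ≤ x) ∧ firstRow (x :: l) = insert x (firstRow l) ∧
      bumped (x :: l) = bumped l) ∨
    ∃ b ∈ firstRow l, x < b ∧ (∀ r ∈ firstRow l, x < r → b ≤ r) ∧
      firstRow (x :: l) = insert x ((firstRow l).erase b) ∧ bumped (x :: l) = b :: bumped l := by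
  by_cases h : ((firstRow l).filter (x < ·)).Nonempty
  · right
    have hb := Finset.mem_filter.1 (Finset.min'_mem _ h)
    refine ⟨_, hb.1, hb.2, fun r hr hxr => Finset.min'_le _ _ (by simp [hr, hxr]), ?_, ?_⟩
    · rw [firstRow, dif_pos h]
    · rw [bumped, dif_pos h]
  · left
    refine ⟨fun r hr => ?_, ?_, ?_⟩
    · by_contra! hx
      exact h ⟨r, by simp [hr, hx]⟩
    · rw [firstRow, dif_neg h]
    · rw [bumped, dif_neg h]

lemma mem_iff_mem_firstRow_or_mem_bumped (l : List α) (y : α) :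
    y ∈ l ↔ y ∈ firstRow l ∨ y ∈ bumped l := by
  induction l with
  | nil => simp [firstRow, bumped]
  | cons x l ih =>
    rcases firstRow_cons x l with ⟨-, h1, h2⟩ | ⟨b, hb, -, -, h1, h2⟩ <;> grind

lemma notMem_firstRow {l : List α} {x : α} (hx : x ∉ l) : x ∉ firstRow l :=
  fun h => hx ((mem_iff_mem_firstRow_or_mem_bumped l x).2 (.inl h))

lemma nodup_bumped_and_disjoint {l : List α} (hl : l.Nodup) :
    (bumped l).Nodup ∧ ∀ y ∈ bumped l, y ∉ firstRow l := by
  induction l with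
  | nil => simp [bumped]
  | cons x l ih =>
    have := mem_iff_mem_firstRow_or_mem_bumped l
    rcases firstRow_cons x l with ⟨-, h1, h2⟩ | ⟨b, hb, -, -, h1, h2⟩ <;> grind

lemma card_firstRow_cons {x : α} {l : List α} (hx : x ∉ l) :
    (firstRow (x :: l)).card + (bumped (x :: l)).length =
      (firstRow l).card + (bumped l).length + 1 ∧
    (firstRow l).card ≤ (firstRow (x :: l)).card := by
  have hx' := notMem_firstRow hx
  rcases firstRow_cons x l with ⟨-, h1, h2⟩ | ⟨b, hb, -, -, h1, h2⟩
  · rw [h1, h2, Finset.card_insert_of_notMem hx']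
    omega
  · rw [h1, h2, Finset.card_insert_of_notMem (by simp [hx']), Finset.card_erase_add_one hb]
    simp [add_assoc]

lemma card_firstRow_add_length_bumped {l : List α} (hl : l.Nodup) :
    (firstRow l).card + (bumped l).length = l.length := by
  induction l with
  | nil => simp [firstRow, bumped]
  | cons x l ih =>
    rw [List.nodup_cons] at hl
    rw [(card_firstRow_cons hl.1).1, ih hl.2, List.length_cons]

lemma firstRow_of_pairwise {l : List α} (hl : l.Pairwise (· > ·)) :
    firstRow l = l.toFinset ∧ bumped l = [] := by
  induction l with
  | nil => simp [firstRow, bumped]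
  | cons x l ih =>
    rw [List.pairwise_cons] at hl
    obtain ⟨h1, h2⟩ := ih hl.2
    rcases firstRow_cons x l with ⟨-, h3, h4⟩ | ⟨b, hb, hxb, -⟩
    · simp [h1, h2, h3, h4]
    · rw [h1, List.mem_toFinset] at hb
      exact absurd hxb (hl.1 b hb).not_gt

lemma le_card_firstRow_append {v u : List α} (hl : (v ++ u).Nodup) (hu : u.Pairwise (· > ·)) :
    u.length ≤ (firstRow (v ++ u)).card := by
  induction v with
  | nil =>
    rw [List.nil_append] at hl ⊢
    rw [(firstRow_of_pairwise hu).1, List.toFinset_card_of_nodup hl]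
  | cons x v ih =>
    rw [List.cons_append, List.nodup_cons] at hl
    exact (ih hl.2).trans (card_firstRow_cons hl.1).2

/-- Schensted: `#{r ∈ firstRow l | r ≤ v}` bounds the length of the increasing subwords with
letters at most `v`. -/
lemma length_le_card_firstRow {l : List α} (hl : l.Nodup) (v : α) {d : List α} (hd : d.Sublist l)
    (hdec : d.Pairwise (· > ·)) (hv : ∀ e ∈ d, e ≤ v) :
    d.length ≤ ((firstRow l).filter (· ≤ v)).card := by
  induction l generalizing v d with
  | nil => simp [List.sublist_nil.1 hd]
  | cons x l ih =>
    rw [List.nodup_cons] at hl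
    have hx := notMem_firstRow hl.1
    rcases List.sublist_cons_iff.1 hd with hd | ⟨d, rfl, hd'⟩
    · refine (ih hl.2 v hd hdec hv).trans ?_
      rcases firstRow_cons x l with ⟨-, h, -⟩ | ⟨b, hb, hxb, -, h, -⟩ <;> rw [h]
      · exact Finset.card_le_card (Finset.filter_subset_filter _ (Finset.subset_insert _ _))
      · by_cases hbv : b ≤ v
        · have : ((insert x ((firstRow l).erase b)).filter (· ≤ v)) =
              insert x (((firstRow l).filter (· ≤ v)).erase b) := by grind
          rw [this, Finset.card_insert_of_notMem (by simp [hx]),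
            Finset.card_erase_add_one (by simp [hb, hbv])]
        · exact Finset.card_le_card (by grind)
    · rw [List.pairwise_cons] at hdec
      have h1 := ih hl.2 x hd' hdec.2 fun e he => (hdec.1 e he).le
      have hxv := hv x (by simp)
      rw [List.length_cons]
      calc d.length + 1 ≤ ((firstRow l).filter (· ≤ x)).card + 1 := by omega
        _ = (insert x ((firstRow l).filter (· ≤ x))).card := by
          rw [Finset.card_insert_of_notMem (by simp [hx])]
        _ ≤ _ := Finset.card_le_card (by
          rcases firstRow_cons x l with ⟨-, h, -⟩ | ⟨b, hb, hxb, -, h, -⟩ <;> rw [h] <;> grind)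

/-- Schensted: the bound `length_le_card_firstRow` is attained. -/
lemma exists_sublist_length_eq_card {l : List α} (hl : l.Nodup) (v : α) :
    ∃ d : List α, d.Sublist l ∧ d.Pairwise (· > ·) ∧ (∀ e ∈ d, e ≤ v) ∧
      d.length = ((firstRow l).filter (· ≤ v)).card := by
  induction l generalizing v with
  | nil => exact ⟨[], by simp [firstRow]⟩
  | cons x l ih =>
    rw [List.nodup_cons] at hl
    have hx := notMem_firstRow hl.1
    have keep (h : ((firstRow l).filter (· ≤ v)).card =
        ((firstRow (x :: l)).filter (· ≤ v)).card) : ∃ d : List α, d.Sublist (x :: l) ∧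
        d.Pairwise (· > ·) ∧ (∀ e ∈ d, e ≤ v) ∧
        d.length = ((firstRow (x :: l)).filter (· ≤ v)).card := by
      obtain ⟨d, h1, h2, h3, h4⟩ := ih hl.2 v
      exact ⟨d, h1.cons x, h2, h3, h4.trans h⟩
    have extend (hxv : x ≤ v) (h : (firstRow (x :: l)).filter (· ≤ v) =
        insert x ((firstRow l).filter (· ≤ x))) : ∃ d : List α, d.Sublist (x :: l) ∧
        d.Pairwise (· > ·) ∧ (∀ e ∈ d, e ≤ v) ∧
        d.length = ((firstRow (x :: l)).filter (· ≤ v)).card := by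
      obtain ⟨d, h1, h2, h3, h4⟩ := ih hl.2 x
      refine ⟨x :: d, h1.cons_cons x, List.pairwise_cons.2 ⟨fun e he => ?_, h2⟩, ?_, ?_⟩
      · exact lt_of_le_of_ne (h3 e he) fun h => hl.1 (h ▸ h1.subset he)
      · simpa [hxv] using fun e he => (h3 e he).trans hxv
      · rw [h, Finset.card_insert_of_notMem (by simp [hx]), List.length_cons, h4]
    rcases firstRow_cons x l with ⟨hle, h, -⟩ | ⟨b, hb, hxb, hmin, h, -⟩
    · by_cases hxv : x ≤ v
      · exact extend hxv (by rw [h]; grind)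
      · exact keep (by rw [h, Finset.filter_insert, if_neg hxv])
    · by_cases hxv : x ≤ v
      · by_cases hbv : b ≤ v
        · refine keep ?_
          have : ((insert x ((firstRow l).erase b)).filter (· ≤ v)) =
              insert x (((firstRow l).filter (· ≤ v)).erase b) := by grind
          rw [h, this, Finset.card_insert_of_notMem (by simp [hx]),
            Finset.card_erase_add_one (by simp [hb, hbv])]
        · exact extend hxv (by rw [h]; grind)
      · refine keep (congrArg _ ?_)
        rw [h]
        grind

/-- The relative order of two neighbouring letters is determined by the first row and the
bumped letters. -/
lemma pair_sublist_iff {l : List α} (hl : l.Nodup) {i j : α} (hij : i < j)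
    (hadj : ∀ y, i < y → ¬ y < j) :
    [i, j].Sublist l ↔ (j ∈ bumped l ∧ i ∈ firstRow l) ∨ [i, j].Sublist (bumped l) := by
  induction l with
  | nil => simp [bumped]
  | cons x l ih =>
    rw [List.nodup_cons] at hl
    have hmem := mem_iff_mem_firstRow_or_mem_bumped l
    replace ih := propext (ih hl.2)
    rw [pair_sublist_cons_iff, ih]
    clear ih
    have hdis := nodup_bumped_and_disjoint hl.2
    rcases firstRow_cons x l with ⟨hle, h1, h2⟩ | ⟨b, hb, hxb, hmin, h1, h2⟩ <;> rw [h1, h2]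
    · grind
    · rw [pair_sublist_cons_iff, hmem j]
      rw [hmem x] at hl
      have hdis' := hdis.2
      simp only [List.mem_cons, Finset.mem_insert, Finset.mem_erase]
      clear h1 h2 hmem hdis
      generalize [i, j].Sublist (bumped l) = P, firstRow l = R, bumped l = B at *
      grind

/-- Reverse bumping the letters of a list, in order, into a row never fails: each of them exceeds
some entry of the row at that moment, and replaces the largest such entry. -/
def ReverseBumpable : Finset α → List α → Prop
  | _, [] => True
  | R, b :: B =>
    ∃ p ∈ R, p < b ∧ (∀ r ∈ R, r < b → r ≤ p) ∧ ReverseBumpable (insert b (R.erase p)) B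

lemma reverseBumpable_cons_iff {R : Finset α} {b p : α} {B : List α} (hp : p ∈ R) (hpb : p < b)
    (hmax : ∀ r ∈ R, r < b → r ≤ p) :
    ReverseBumpable R (b :: B) ↔ ReverseBumpable (insert b (R.erase p)) B := by
  constructor
  · rintro ⟨q, hq, hqb, hqmax, h⟩
    rwa [le_antisymm (hqmax p hp hpb) (hmax q hq hqb)]
  · exact fun h => ⟨p, hp, hpb, hmax, h⟩

/-- Adding an entry to the row does not affect reverse bumping, if enough entries lie below it. -/
lemma reverseBumpable_insert_iff {B : List α} {R : Finset α} {z : α} (hz : z ∉ R) (hB : B.Nodup)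
    (hdisj : ∀ b ∈ B, b ∉ insert z R) (hcard : B.length ≤ (R.filter (· < z)).card) :
    ReverseBumpable (insert z R) B ↔ ReverseBumpable R B := by
  induction B generalizing R z with
  | nil => simp [ReverseBumpable]
  | cons b B ih =>
    rw [List.nodup_cons] at hB
    rw [List.length_cons] at hcard
    obtain ⟨q, hq⟩ : (R.filter (· < z)).Nonempty := Finset.card_pos.1 (by omega)
    have hbz : b ∉ insert z R := hdisj b (by simp)
    by_cases hex : (R.filter (· < b)).Nonempty
    · obtain ⟨hp, hpb⟩ := Finset.mem_filter.1 (Finset.max'_mem _ hex)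
      have hmax : ∀ r ∈ R, r < b → r ≤ (R.filter (· < b)).max' hex :=
        fun r hr hrb => Finset.le_max' _ _ (by simp [hr, hrb])
      generalize (R.filter (· < b)).max' hex = p at hp hpb hmax
      rw [reverseBumpable_cons_iff hp hpb hmax]
      by_cases hc : p < z ∧ z < b
      · rw [reverseBumpable_cons_iff (Finset.mem_insert_self z R) hc.2 (by clear ih; grind)]
        have h1 : insert b ((insert z R).erase z) = insert p (insert b (R.erase p)) := by clear ih; grind
        have h2 : (insert b (R.erase p)).filter (· < p) = (R.filter (· < z)).erase p := by clear ih; grind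
        rw [h1]
        refine ih (by clear ih; grind) hB.2 (by clear ih; grind) ?_
        rw [h2, Finset.card_erase_of_mem (by simp [hp, hc.1])]
        omega
      · rw [reverseBumpable_cons_iff (Finset.mem_insert_of_mem hp) hpb (by clear ih; grind)]
        have h1 : insert b ((insert z R).erase p) = insert z (insert b (R.erase p)) := by clear ih; grind
        rw [h1]
        refine ih (by clear ih; grind) hB.2 (by clear ih; grind) ?_
        by_cases hzp : z < p
        · have h2 : (insert b (R.erase p)).filter (· < z) = R.filter (· < z) := by clear ih; grind
          rw [h2]
          omega
        · have h2 : (insert b (R.erase p)).filter (· < z) =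
              insert b ((R.filter (· < z)).erase p) := by clear ih; grind
          rw [h2, Finset.card_insert_of_notMem (by grind),
            Finset.card_erase_add_one (by grind)]
          omega
    · constructor
      · rintro ⟨p, hp, hpb, -⟩
        rcases Finset.mem_insert.1 hp with rfl | hp
        · exact absurd ⟨q, by simp at hq ⊢; exact ⟨hq.1, hq.2.trans hpb⟩⟩ hex
        · exact absurd ⟨p, by simp [hp, hpb]⟩ hex
      · rintro ⟨p, hp, hpb, -⟩
        exact absurd ⟨p, by simp [hp, hpb]⟩ hex

/-- If the first row keeps the length of the initial increasing run, then inserting the last letter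
bumps, and this step can be undone. -/
lemma firstRow_cons_of_card_eq {x : α} {v u : List α} (hl : (x :: (v ++ u)).Nodup)
    (hu : u.Pairwise (· > ·)) (hc : (firstRow (x :: (v ++ u))).card = u.length) :
    (firstRow (v ++ u)).card = u.length ∧ ∃ b, bumped (x :: (v ++ u)) = b :: bumped (v ++ u) ∧
      x ∈ firstRow (x :: (v ++ u)) ∧ x < b ∧ (∀ r ∈ firstRow (x :: (v ++ u)), r < b → r ≤ x) ∧
      firstRow (v ++ u) = insert b ((firstRow (x :: (v ++ u))).erase x) := by
  rw [List.nodup_cons] at hl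
  have hx := notMem_firstRow hl.1
  have hle := le_card_firstRow_append hl.2 hu
  have hle' := (card_firstRow_cons hl.1).2
  refine ⟨by omega, ?_⟩
  rcases firstRow_cons x (v ++ u) with ⟨-, h, -⟩ | ⟨b, hb, hxb, hmin, h1, h2⟩
  · rw [h, Finset.card_insert_of_notMem hx] at hc
    omega
  · refine ⟨b, h2, ?_, hxb, ?_, ?_⟩ <;> rw [h1] <;> grind

lemma reverseBumpable_firstRow {v u : List α} (hl : (v ++ u).Nodup) (hu : u.Pairwise (· > ·))
    (hc : (firstRow (v ++ u)).card = u.length) :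
    ReverseBumpable (firstRow (v ++ u)) (bumped (v ++ u)) := by
  induction v with
  | nil => simp [(firstRow_of_pairwise hu).2, ReverseBumpable]
  | cons x v ih =>
    obtain ⟨hc', b, hb, hx, hxb, hmax, hR⟩ := firstRow_cons_of_card_eq hl hu hc
    rw [List.cons_append, hb, reverseBumpable_cons_iff hx hxb hmax, ← hR]
    exact ih hl.of_cons hc'

/-- A word whose first row keeps the length of the initial increasing run is determined by its
first row and its bumped letters. -/
lemma eq_of_firstRow_eq_of_bumped_eq {v u v' u' : List α} (hl : (v ++ u).Nodup)
    (hl' : (v' ++ u').Nodup) (hu : u.Pairwise (· > ·)) (hu' : u'.Pairwise (· > ·))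
    (hc : (firstRow (v ++ u)).card = u.length) (hc' : (firstRow (v' ++ u')).card = u'.length)
    (hR : firstRow (v ++ u) = firstRow (v' ++ u')) (hB : bumped (v ++ u) = bumped (v' ++ u')) :
    v ++ u = v' ++ u' := by
  induction v generalizing v' with
  | nil =>
    cases v' with
    | nil =>
      simp only [List.nil_append] at hl hl' hR ⊢
      rw [(firstRow_of_pairwise hu).1, (firstRow_of_pairwise hu').1] at hR
      refine List.Perm.eq_of_pairwise' hu hu' ?_
      rw [List.perm_ext_iff_of_nodup hl hl']
      simpa [Finset.ext_iff] using hR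
    | cons x' v' =>
      obtain ⟨-, b, hb, -⟩ := firstRow_cons_of_card_eq hl' hu' hc'
      rw [List.nil_append, (firstRow_of_pairwise hu).2, List.cons_append, hb] at hB
      simp at hB
  | cons x v ih =>
    obtain ⟨hd, b, hb, hx, hxb, hmax, h⟩ := firstRow_cons_of_card_eq hl hu hc
    cases v' with
    | nil =>
      rw [List.nil_append, (firstRow_of_pairwise hu').2, List.cons_append, hb] at hB
      simp at hB
    | cons x' v' =>
      obtain ⟨hd', b', hb', hx', hxb', hmax', h'⟩ := firstRow_cons_of_card_eq hl' hu' hc'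
      simp only [List.cons_append] at hR hB ⊢
      rw [hb, hb', List.cons.injEq] at hB
      obtain ⟨rfl, hB⟩ := hB
      rw [hR] at hx hmax h
      obtain rfl := le_antisymm (hmax' x hx hxb) (hmax x' hx' hxb')
      rw [ih hl.of_cons hl'.of_cons hd hd' (h.trans h'.symm) hB]

/-- Reverse bumping reconstructs a word with prescribed first row and bumped letters. -/
lemma exists_word_of_reverseBumpable {B : List α} {R : Finset α} (hB : B.Nodup)
    (hdisj : ∀ b ∈ B, b ∉ R) (h : ReverseBumpable R B) :
    ∃ v u : List α, (v ++ u).Nodup ∧ u.Pairwise (· > ·) ∧ u.length = R.card ∧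
      firstRow (v ++ u) = R ∧ bumped (v ++ u) = B := by
  induction B generalizing R with
  | nil =>
    have hs : (R.sort (· ≥ ·)).Pairwise (· > ·) := (Finset.sortedGT_sort R).pairwise
    refine ⟨[], R.sort (· ≥ ·), by simp, hs, by simp, ?_, ?_⟩
    · simp [(firstRow_of_pairwise hs).1]
    · simp [(firstRow_of_pairwise hs).2]
  | cons b B ih =>
    rw [List.nodup_cons] at hB
    obtain ⟨p, hp, hpb, hmax, h⟩ := h
    have hbR : b ∉ R := hdisj b (by simp)
    obtain ⟨v, u, hl, hu, hlen, h1, h2⟩ := ih hB.2 (by grind) h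
    have hpl : p ∉ v ++ u := by
      rw [mem_iff_mem_firstRow_or_mem_bumped, h1, h2]
      grind
    refine ⟨p :: v, u, List.nodup_cons.2 ⟨hpl, hl⟩, hu, ?_, ?_⟩
    · rw [hlen, Finset.card_insert_of_notMem (by simp [hbR]), Finset.card_erase_add_one hp]
    · rw [List.cons_append]
      rcases firstRow_cons p (v ++ u) with ⟨hle, -⟩ | ⟨c, hc, hpc, hmin, h3, h4⟩
      · exact absurd (hle b (by simp [h1])) (not_le.2 hpb)
      · rw [h1] at hc hmin h3
        have hcb := hmin b (by simp) hpb
        obtain rfl : c = b := by grind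
        rw [h3, h4, h2]
        exact ⟨by grind, rfl⟩

end FirstRow

section Words

variable {α : Type*} [LinearOrder α]

/-- Reversed words starting with an increasing run of length `m`, such that only the last letter
extends the first row beyond this length. -/
def LateWord (m : ℕ) (l : List α) : Prop :=
  ∃ y v u, l = y :: (v ++ u) ∧ u.Pairwise (· > ·) ∧ u.length = m ∧
    (firstRow (v ++ u)).card = m ∧ ∀ r ∈ firstRow (v ++ u), r < y

/-- Reversed words starting with an increasing run of length `m`, whose first row has length
`m`. -/
def EarlyWord (m : ℕ) (l : List α) : Prop :=
  ∃ v u, l = v ++ u ∧ u.Pairwise (· > ·) ∧ u.length = m ∧ (firstRow (v ++ u)).card = m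

lemma EarlyWord.eq {m : ℕ} {l l' : List α} (h : EarlyWord m l) (h' : EarlyWord m l')
    (hl : l.Nodup) (hl' : l'.Nodup) (hR : firstRow l = firstRow l')
    (hB : bumped l = bumped l') : l = l' := by
  obtain ⟨v, u, rfl, hu, hum, hc⟩ := h
  obtain ⟨v', u', rfl, hu', hum', hc'⟩ := h'
  exact eq_of_firstRow_eq_of_bumped_eq hl hl' hu hu' (by omega) (by omega) hR hB

lemma firstRow_cons_of_forall_lt {y : α} {l : List α} (h : ∀ r ∈ firstRow l, r < y) :
    firstRow (y :: l) = insert y (firstRow l) ∧ bumped (y :: l) = bumped l := by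
  rcases firstRow_cons y l with ⟨-, h'⟩ | ⟨b, hb, hyb, -⟩
  · exact h'
  · exact absurd (h b hb) hyb.not_gt

lemma LateWord.eq {m : ℕ} {l l' : List α} (h : LateWord m l) (h' : LateWord m l')
    (hl : l.Nodup) (hl' : l'.Nodup) (hR : firstRow l = firstRow l')
    (hB : bumped l = bumped l') : l = l' := by
  obtain ⟨y, v, u, rfl, hu, hum, hc, hy⟩ := h
  obtain ⟨y', v', u', rfl, hu', hum', hc', hy'⟩ := h'
  obtain ⟨h1, h2⟩ := firstRow_cons_of_forall_lt hy
  obtain ⟨h1', h2'⟩ := firstRow_cons_of_forall_lt hy'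
  rw [h1, h1'] at hR
  rw [h2, h2'] at hB
  have hle {y y' : α} {R R' : Finset α} (hR : insert y R = insert y' R')
      (hy' : ∀ r ∈ R', r < y') : y ≤ y' := by
    have := hR ▸ Finset.mem_insert_self y R
    rcases Finset.mem_insert.1 this with h | h
    exacts [h.le, (hy' y h).le]
  obtain rfl := le_antisymm (hle hR hy') (hle hR.symm hy)
  have hR' : firstRow (v ++ u) = firstRow (v' ++ u') := by
    rw [← Finset.erase_insert (fun h => (hy y h).false), hR,
      Finset.erase_insert (fun h => (hy' y h).false)]
  rw [EarlyWord.eq ⟨v, u, rfl, hu, hum, hc⟩ ⟨v', u', rfl, hu', hum', hc'⟩ hl.of_cons hl'.of_cons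
    hR' hB]

lemma LateWord.exists_earlyWord {m : ℕ} {l : List α} (h : LateWord m l) (hl : l.Nodup)
    (hlen : l.length ≤ 2 * m + 1) :
    ∃ l' : List α, l'.Nodup ∧ EarlyWord (m + 1) l' ∧ firstRow l' = firstRow l ∧
      bumped l' = bumped l := by
  obtain ⟨y, v, u, rfl, hu, hum, hc, hy⟩ := h
  obtain ⟨h1, h2⟩ := firstRow_cons_of_forall_lt hy
  have hyR : y ∉ firstRow (v ++ u) := fun h => (hy y h).false
  obtain ⟨hB, hdisj⟩ := nodup_bumped_and_disjoint hl
  have hcard := card_firstRow_add_length_bumped hl.of_cons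
  rw [List.length_cons] at hlen
  rw [h1, h2] at *
  have hfeas : ReverseBumpable (insert y (firstRow (v ++ u))) (bumped (v ++ u)) := by
    rw [reverseBumpable_insert_iff hyR hB hdisj (by
      rw [Finset.filter_true_of_mem hy]
      omega)]
    exact reverseBumpable_firstRow hl.of_cons hu (hc.trans hum.symm)
  obtain ⟨v', u', hl', hu', hlen', hR, hB'⟩ := exists_word_of_reverseBumpable hB hdisj hfeas
  have hm : (insert y (firstRow (v ++ u))).card = m + 1 := by
    rw [Finset.card_insert_of_notMem hyR, hc]
  exact ⟨v' ++ u', hl', ⟨v', u', rfl, hu', hlen'.trans hm, by rw [hR, hm]⟩, hR, hB'⟩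

lemma EarlyWord.exists_lateWord {m : ℕ} {l : List α} (h : EarlyWord (m + 1) l) (hl : l.Nodup)
    (hlen : l.length ≤ 2 * m + 1) :
    ∃ l' : List α, l'.Nodup ∧ LateWord m l' ∧ firstRow l' = firstRow l ∧
      bumped l' = bumped l := by
  obtain ⟨v, u, rfl, hu, hum, hc⟩ := h
  obtain ⟨hB, hdisj⟩ := nodup_bumped_and_disjoint hl
  have hcard := card_firstRow_add_length_bumped hl
  have hfeas := reverseBumpable_firstRow hl hu (hc.trans hum.symm)
  have hne : (firstRow (v ++ u)).Nonempty := Finset.card_pos.1 (by omega)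
  have hy := Finset.max'_mem _ hne
  have hmax : ∀ r ∈ firstRow (v ++ u), r ≤ (firstRow (v ++ u)).max' hne :=
    fun r hr => Finset.le_max' _ r hr
  generalize (firstRow (v ++ u)).max' hne = y at hy hmax
  generalize firstRow (v ++ u) = R, bumped (v ++ u) = B at *
  have hlt : ∀ r ∈ R.erase y, r < y := fun r hr =>
    lt_of_le_of_ne (hmax r (Finset.mem_of_mem_erase hr)) (Finset.ne_of_mem_erase hr)
  have hRc : (R.erase y).card = m := by rw [Finset.card_erase_of_mem hy, hc]; rfl
  rw [← Finset.insert_erase hy] at hfeas hdisj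
  rw [reverseBumpable_insert_iff (Finset.notMem_erase y R) hB hdisj (by
    rw [Finset.filter_true_of_mem hlt]
    omega)] at hfeas
  obtain ⟨v', u', hl', hu', hlen', hR, hB'⟩ := exists_word_of_reverseBumpable hB
    (fun b hb h => hdisj b hb (Finset.mem_insert_of_mem h)) hfeas
  have hlt' : ∀ r ∈ firstRow (v' ++ u'), r < y := by rwa [hR]
  obtain ⟨h1, h2⟩ := firstRow_cons_of_forall_lt hlt'
  have hyl : y ∉ v' ++ u' := by
    rw [mem_iff_mem_firstRow_or_mem_bumped, hR, hB']
    rintro (h | h)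
    · exact Finset.notMem_erase y R h
    · exact hdisj y h (Finset.mem_insert_self _ _)
  refine ⟨y :: (v' ++ u'), List.nodup_cons.2 ⟨hyl, hl'⟩,
    ⟨y, v', u', rfl, hu', hlen'.trans hRc, by rw [hR, hRc], hlt'⟩, ?_, ?_⟩
  · rw [h1, hR, Finset.insert_erase hy]
  · rw [h2, hB']

end Words

section Prefixes

variable {n : ℕ}

/-- The first `t` values of a permutation, last one first. -/
def revPrefix (w : Equiv.Perm (Fin n)) (t : ℕ) : List (Fin n) :=
  ((List.ofFn w).take t).reverse

lemma nodup_ofFn (w : Equiv.Perm (Fin n)) : (List.ofFn w).Nodup :=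
  List.nodup_ofFn.2 w.injective

lemma nodup_revPrefix (w : Equiv.Perm (Fin n)) (t : ℕ) : (revPrefix w t).Nodup :=
  List.nodup_reverse.2 ((nodup_ofFn w).sublist (List.take_sublist _ _))

lemma length_revPrefix (w : Equiv.Perm (Fin n)) {t : ℕ} (ht : t ≤ n) :
    (revPrefix w t).length = t := by
  simp [revPrefix, ht]

lemma revPrefix_succ (w : Equiv.Perm (Fin n)) {t : ℕ} (ht : t < n) :
    revPrefix w (t + 1) = w ⟨t, ht⟩ :: revPrefix w t := by
  rw [revPrefix, List.take_succ_eq_append_getElem (by simpa using ht)]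
  simp [revPrefix]

lemma exists_revPrefix_eq_append (w : Equiv.Perm (Fin n)) {m t : ℕ} (hmt : m ≤ t) :
    ∃ v, revPrefix w t = v ++ revPrefix w m := by
  refine ⟨(((List.ofFn w).take t).drop m).reverse, ?_⟩
  rw [revPrefix, revPrefix, ← List.reverse_append]
  conv_lhs => rw [← List.take_append_drop m ((List.ofFn w).take t)]
  rw [List.take_take, min_eq_left hmt]

lemma prefixInc_iff (s : ℕ) (w : Equiv.Perm (Fin n)) :
    PrefixInc n s w ↔ (revPrefix w (n - s)).Pairwise (· > ·) := by
  rw [revPrefix, List.pairwise_reverse, List.pairwise_iff_getElem]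
  simp only [List.length_take, List.length_ofFn, List.getElem_take, List.getElem_ofFn]
  constructor
  · intro h i j hi hj hij
    exact h ⟨i, by omega⟩ ⟨j, by omega⟩ hij (by simp; omega)
  · intro h i j hij hj
    exact h i j (by omega) (by omega) hij

lemma hasIncSubseqPrefix_iff_sublist (w : Equiv.Perm (Fin n)) (t k : ℕ) :
    HasIncSubseqPrefix w t k ↔
      ∃ d : List (Fin n), d.Sublist (revPrefix w t) ∧ d.Pairwise (· > ·) ∧ d.length = k := by
  constructor
  · rintro ⟨f, hf, hft, hwf⟩
    refine ⟨(List.ofFn fun j => w (f j)).reverse, ?_, ?_, by simp⟩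
    · rw [revPrefix, List.reverse_sublist, List.sublist_iff_exists_fin_orderEmbedding_get_eq]
      refine ⟨OrderEmbedding.ofStrictMono
        (fun j => ⟨f (j.cast (by simp)), by simpa using hft _⟩) fun i j hij => ?_, fun j => ?_⟩
      · exact hf (by simpa using hij)
      · simp
        rfl
    · rw [List.pairwise_reverse, List.pairwise_ofFn]
      exact fun i j hij => hwf hij
  · rintro ⟨d, hd, hdec, rfl⟩
    rw [← List.reverse_reverse d, revPrefix, List.reverse_sublist,
      List.sublist_iff_exists_fin_orderEmbedding_get_eq] at hd
    obtain ⟨f, hf⟩ := hd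
    have hlt (j) : (f j : ℕ) < min t n := by simpa using (f j).2
    refine ⟨fun j => ⟨f (j.cast (by simp)), by have := hlt (j.cast (by simp)); omega⟩,
      fun i j hij => f.strictMono (by simpa using hij),
      fun j => by have := hlt (j.cast (by simp)); simp; omega, fun i j hij => ?_⟩
    have h1 := hf (i.cast (by simp))
    have h2 := hf (j.cast (by simp))
    simp only [List.get_eq_getElem, List.getElem_take, List.getElem_ofFn] at h1 h2
    simp only
    rw [← h1, ← h2]
    exact List.pairwise_iff_getElem.1 (List.pairwise_reverse.2 hdec) _ _ _ _ hij

lemma hasIncSubseqPrefix_iff (w : Equiv.Perm (Fin n)) (t k : ℕ) :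
    HasIncSubseqPrefix w t k ↔ k ≤ (firstRow (revPrefix w t)).card := by
  rw [hasIncSubseqPrefix_iff_sublist]
  constructor
  · rintro ⟨d, hd, hdec, rfl⟩
    cases n with
    | zero => simp [Subsingleton.elim d []]
    | succ n =>
      exact (length_le_card_firstRow (nodup_revPrefix w t) (Fin.last n) hd hdec
        fun e _ => Fin.le_last e).trans (Finset.card_filter_le _ _)
  · intro hk
    cases n with
    | zero =>
      rw [Subsingleton.elim (firstRow _) ∅] at hk
      exact ⟨[], by simp, by simp, by simp at hk ⊢; omega⟩
    | succ n =>
      obtain ⟨d, h1, h2, -, h4⟩ := exists_sublist_length_eq_card (nodup_revPrefix w t) (Fin.last n)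
      rw [Finset.filter_true_of_mem fun r _ => Fin.le_last r] at h4
      refine ⟨d.take k, (List.take_sublist _ _).trans h1, h2.sublist (List.take_sublist _ _), ?_⟩
      simp only [List.length_take]
      omega

lemma le_card_firstRow_revPrefix {s t : ℕ} {w : Equiv.Perm (Fin n)} (hw : PrefixInc n s w)
    (ht : n - s ≤ t) : n - s ≤ (firstRow (revPrefix w t)).card := by
  have hnd := nodup_revPrefix w t
  obtain ⟨v, hv⟩ := exists_revPrefix_eq_append w ht
  rw [hv] at hnd ⊢
  simpa [length_revPrefix w (Nat.sub_le n s)] using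
    le_card_firstRow_append hnd ((prefixInc_iff s w).1 hw)

lemma eq_revPrefix_of_append_eq {w : Equiv.Perm (Fin n)} {m t : ℕ} {v u : List (Fin n)}
    (hmt : m ≤ t) (ht : t ≤ n) (h : revPrefix w t = v ++ u) (hu : u.length = m) :
    u = revPrefix w m := by
  obtain ⟨v', hv⟩ := exists_revPrefix_eq_append w hmt
  rw [hv] at h
  exact (List.append_inj_right' h
    ((length_revPrefix w (hmt.trans ht)).trans hu.symm)).symm

lemma memCa_iff_lateWord {s a : ℕ} (ha1 : n - s + 1 ≤ a) (ha2 : a ≤ n)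
    (π : Equiv.Perm (Fin n)) : MemCa n s a π ↔ LateWord (n - s) (revPrefix π a) := by
  obtain ⟨t, rfl⟩ : ∃ t, a = t + 1 := ⟨a - 1, by omega⟩
  have hnd := nodup_revPrefix π (t + 1)
  rw [MemCa, hasIncSubseqPrefix_iff, hasIncSubseqPrefix_iff, Nat.add_sub_cancel]
  rw [revPrefix_succ π ha2] at hnd ⊢
  constructor
  · rintro ⟨hinc, h1, h2⟩
    have hle := le_card_firstRow_revPrefix hinc (show n - s ≤ t by omega)
    obtain ⟨v, hv⟩ := exists_revPrefix_eq_append π (show n - s ≤ t by omega)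
    refine ⟨_, v, _, by rw [hv], (prefixInc_iff s π).1 hinc,
      length_revPrefix π (Nat.sub_le n s), by rw [← hv]; omega, ?_⟩
    rw [← hv]
    have hy := notMem_firstRow (List.nodup_cons.1 hnd).1
    rcases firstRow_cons (π ⟨t, ha2⟩) (revPrefix π t) with ⟨hmax, -⟩ | ⟨b, hb, -, -, h3, -⟩
    · exact fun r hr => lt_of_le_of_ne (hmax r hr) fun h => hy (h ▸ hr)
    · rw [h3, Finset.card_insert_of_notMem (by simp [hy]), Finset.card_erase_add_one hb] at h1
      omega
  · rintro ⟨y, v, u, h, hu, hum, hc, hy⟩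
    obtain ⟨rfl, h'⟩ := List.cons_eq_cons.1 h
    rw [← h'] at hc hy
    have := eq_revPrefix_of_append_eq (show n - s ≤ t by omega) (by omega) h' hum
    refine ⟨(prefixInc_iff s π).2 (this ▸ hu), ?_, by omega⟩
    rw [(firstRow_cons_of_forall_lt hy).1,
      Finset.card_insert_of_notMem fun h => (hy _ h).false, hc]

lemma avoids_iff_earlyWord {s a : ℕ} (ha1 : n - s ≤ a) (ha2 : a ≤ n)
    (w : Equiv.Perm (Fin n)) :
    (PrefixInc n s w ∧ ∀ b, n - s + 1 ≤ b → b ≤ a → ¬ MemCa n s b w) ↔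
      EarlyWord (n - s) (revPrefix w a) := by
  constructor
  · rintro ⟨hinc, hb⟩
    obtain ⟨v, hv⟩ := exists_revPrefix_eq_append w ha1
    refine ⟨v, _, hv, (prefixInc_iff s w).1 hinc, length_revPrefix w (Nat.sub_le n s), ?_⟩
    rw [← hv]
    refine le_antisymm ?_ (le_card_firstRow_revPrefix hinc ha1)
    by_contra! hlt
    have hex : ∃ b, HasIncSubseqPrefix w b (n - s + 1) := ⟨a, (hasIncSubseqPrefix_iff _ _ _).2 hlt⟩
    classical
    have hfind := Nat.find_spec hex
    have hba : Nat.find hex ≤ a := Nat.find_min' hex ((hasIncSubseqPrefix_iff _ _ _).2 hlt)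
    have hlen : n - s + 1 ≤ Nat.find hex := by
      have h1 := (hasIncSubseqPrefix_iff _ _ _).1 hfind
      have h2 := card_firstRow_add_length_bumped (nodup_revPrefix w (Nat.find hex))
      rw [length_revPrefix w (hba.trans ha2)] at h2
      omega
    exact hb _ hlen hba ⟨hinc, hfind, Nat.find_min hex (by omega)⟩
  · rintro ⟨v, u, h, hu, hum, hc⟩
    have hu' := eq_revPrefix_of_append_eq ha1 ha2 h hum
    refine ⟨(prefixInc_iff s w).2 (hu' ▸ hu), fun b _ hba hmem => ?_⟩
    obtain ⟨f, h1, h2, h3⟩ := hmem.2.1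
    have := (hasIncSubseqPrefix_iff w a _).1 ⟨f, h1, fun j => (h2 j).trans_le hba, h3⟩
    rw [h, hc] at this
    omega

lemma exists_perm_revPrefix_eq (π : Equiv.Perm (Fin n)) {a : ℕ} (ha : a ≤ n) {l : List (Fin n)}
    (hl : l.Nodup) (hmem : ∀ x, x ∈ l ↔ x ∈ revPrefix π a) :
    ∃ w : Equiv.Perm (Fin n), revPrefix w a = l ∧
      (List.ofFn w).drop a = (List.ofFn π).drop a := by
  have hlp := (List.perm_ext_iff_of_nodup hl (nodup_revPrefix π a)).2 hmem
  have hla : l.reverse.length = a := by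
    rw [List.length_reverse, hlp.length_eq, length_revPrefix π ha]
  have hperm : (l.reverse ++ (List.ofFn π).drop a).Perm (List.ofFn π) := by
    conv_rhs => rw [← List.take_append_drop a (List.ofFn π)]
    refine List.Perm.append_right _ ((List.reverse_perm l).trans (hlp.trans ?_))
    exact List.reverse_perm _
  have hlen : (l.reverse ++ (List.ofFn π).drop a).length = n := by
    rw [hperm.length_eq, List.length_ofFn]
  have hnd := hperm.nodup_iff.2 (nodup_ofFn π)
  have hinj : Function.Injective
      fun i : Fin n => (l.reverse ++ (List.ofFn π).drop a).get (i.cast hlen.symm) :=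
    (List.nodup_iff_injective_get.1 hnd).comp (Fin.cast_injective _)
  have hof : List.ofFn (Equiv.ofBijective _ (Finite.injective_iff_bijective.1 hinj)) =
      l.reverse ++ (List.ofFn π).drop a := by
    apply List.ext_getElem
    · rw [List.length_ofFn]
      exact hlen.symm
    · simp
  refine ⟨Equiv.ofBijective _ (Finite.injective_iff_bijective.1 hinj), ?_, ?_⟩
  · rw [revPrefix, hof, List.take_left' hla, List.reverse_reverse]
  · rw [hof, List.drop_left' hla]

lemma pair_sublist_ofFn_iff (w : Equiv.Perm (Fin n)) {x y : Fin n} (hxy : x ≠ y) :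
    [x, y].Sublist (List.ofFn w) ↔ w.symm x < w.symm y := by
  have key {x y : Fin n} (h : [x, y].Sublist (List.ofFn w)) : w.symm x < w.symm y := by
    have : (List.ofFn w).Pairwise fun x y => w.symm x < w.symm y := by
      rw [List.pairwise_ofFn]
      simp
    exact List.pairwise_iff_forall_sublist.1 this h
  refine ⟨key, fun h => ?_⟩
  have hx : x ∈ List.ofFn w := by simpa [List.mem_ofFn] using w.surjective x
  have hy : y ∈ List.ofFn w := by simpa [List.mem_ofFn] using w.surjective y
  obtain ⟨s, t, hst⟩ := List.append_of_mem hx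
  rw [hst, List.mem_append, List.mem_cons] at hy
  rcases hy with hy | rfl | hy
  · refine absurd h (key ?_).not_gt
    rw [hst]
    exact (List.singleton_sublist.2 hy).append (List.singleton_sublist.2 (by simp))
  · exact absurd rfl hxy
  · rw [hst]
    exact ((List.singleton_sublist.2 hy).cons_cons x).trans (List.sublist_append_right _ _)

lemma pair_sublist_append_iff {β : Type*} {x y : β} {A B : List β} :
    [x, y].Sublist (A ++ B) ↔
      [x, y].Sublist A ∨ (x ∈ A ∧ y ∈ B) ∨ [x, y].Sublist B := by
  induction A with
  | nil => simp
  | cons z A ih =>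
    rw [List.cons_append, pair_sublist_cons_iff, pair_sublist_cons_iff, ih]
    simp only [List.mem_append, List.mem_cons]
    tauto

/-- The first row and the bumped letters of a prefix, together with the rest of the word. -/
def rowData (a : ℕ) (w : Equiv.Perm (Fin n)) : Finset (Fin n) × List (Fin n) × List (Fin n) :=
  (firstRow (revPrefix w a), bumped (revPrefix w a), (List.ofFn w).drop a)

lemma rowData_eq_iff {a : ℕ} {w w' : Equiv.Perm (Fin n)} :
    rowData a w = rowData a w' ↔ firstRow (revPrefix w a) = firstRow (revPrefix w' a) ∧
      bumped (revPrefix w a) = bumped (revPrefix w' a) ∧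
      (List.ofFn w).drop a = (List.ofFn w').drop a := by
  simp [rowData]

lemma eq_of_rowData_eq {a : ℕ} {w w' : Equiv.Perm (Fin n)} (hpre : revPrefix w a = revPrefix w' a)
    (h : rowData a w = rowData a w') : w = w' := by
  have hof : List.ofFn w = List.ofFn w' := by
    rw [← List.take_append_drop a (List.ofFn w), (rowData_eq_iff.1 h).2.2,
      List.reverse_injective hpre, List.take_append_drop]
  exact DFunLike.coe_injective (List.ofFn_injective hof)

lemma symm_lt_symm_iff {a : ℕ} {w w' : Equiv.Perm (Fin n)} (h : rowData a w = rowData a w')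
    {i j : Fin n} (hij : i < j) (hadj : ∀ y, i < y → ¬ y < j) :
    w.symm j < w.symm i ↔ w'.symm j < w'.symm i := by
  obtain ⟨hR, hB, hdrop⟩ := rowData_eq_iff.1 h
  have hmem (x) : x ∈ (List.ofFn w).take a ↔ x ∈ (List.ofFn w').take a := by
    rw [← List.mem_reverse, ← List.mem_reverse (as := (List.ofFn w').take a)]
    change x ∈ revPrefix w a ↔ x ∈ revPrefix w' a
    rw [mem_iff_mem_firstRow_or_mem_bumped, hR, hB, ← mem_iff_mem_firstRow_or_mem_bumped]
  have hpre : [j, i].Sublist ((List.ofFn w).take a) ↔ [j, i].Sublist ((List.ofFn w').take a) := by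
    rw [← List.reverse_sublist, ← List.reverse_sublist (l₂ := (List.ofFn w').take a)]
    change [i, j].Sublist (revPrefix w a) ↔ [i, j].Sublist (revPrefix w' a)
    rw [pair_sublist_iff (nodup_revPrefix w a) hij hadj,
      pair_sublist_iff (nodup_revPrefix w' a) hij hadj, hR, hB]
  rw [← pair_sublist_ofFn_iff w hij.ne', ← pair_sublist_ofFn_iff w' hij.ne',
    ← List.take_append_drop a (List.ofFn w), ← List.take_append_drop a (List.ofFn w'),
    pair_sublist_append_iff, pair_sublist_append_iff, hpre, hmem, hdrop]

lemma exists_perm_rowData_eq (π : Equiv.Perm (Fin n)) {a : ℕ} (ha : a ≤ n) {l : List (Fin n)}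
    (hl : l.Nodup) (hR : firstRow l = firstRow (revPrefix π a))
    (hB : bumped l = bumped (revPrefix π a)) :
    ∃ w : Equiv.Perm (Fin n), revPrefix w a = l ∧ rowData a w = rowData a π := by
  obtain ⟨w, hw, hdrop⟩ := exists_perm_revPrefix_eq π ha hl fun x => by
    rw [mem_iff_mem_firstRow_or_mem_bumped, hR, hB, ← mem_iff_mem_firstRow_or_mem_bumped]
  exact ⟨w, hw, by rw [rowData_eq_iff, hw]; exact ⟨hR, hB, hdrop⟩⟩

end Prefixes

/-- There is a bijection `φ` from `C_{n,s,a}` onto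
`C_{n,s-1} \ ⋃_{b=n-s+2}^{a} C_{n,s-1,b}` that preserves the inverse descent set:
for all 1-indexed values `i ∈ {1,…,n-1}`, `i+1` appears before `i` in `π` iff it
does so in `φ(π)` (0-indexed below: values `i` and `i+1` for `i ∈ {0,…,n-2}`). -/
theorem phi_bijection (n s a : ℕ) (hs : 1 ≤ s) (h : 2 * s ≤ n)
    (ha1 : n - s + 1 ≤ a) (ha2 : a ≤ n) :
    ∃ φ : {π : Equiv.Perm (Fin n) // MemCa n s a π} →
        {w : Equiv.Perm (Fin n) //
          PrefixInc n (s - 1) w ∧ ∀ b, n - s + 2 ≤ b → b ≤ a → ¬ MemCa n (s - 1) b w},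
      Function.Bijective φ ∧
        ∀ (π : {π : Equiv.Perm (Fin n) // MemCa n s a π}) (i : ℕ) (hi : i + 1 < n),
          (π.1.symm ⟨i + 1, hi⟩ < π.1.symm ⟨i, Nat.lt_of_succ_lt hi⟩ ↔
            (φ π).1.symm ⟨i + 1, hi⟩ < (φ π).1.symm ⟨i, Nat.lt_of_succ_lt hi⟩) := by
  have hm : n - (s - 1) = n - s + 1 := by omega
  have hm' : n - s + 2 = n - (s - 1) + 1 := by omega
  have hearly (w : Equiv.Perm (Fin n)) :
      (PrefixInc n (s - 1) w ∧ ∀ b, n - s + 2 ≤ b → b ≤ a → ¬ MemCa n (s - 1) b w) ↔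
        EarlyWord (n - s + 1) (revPrefix w a) := by
    rw [hm', avoids_iff_earlyWord (by omega) ha2, hm]
  have hlate := memCa_iff_lateWord ha1 ha2
  have hlen (w : Equiv.Perm (Fin n)) : (revPrefix w a).length ≤ 2 * (n - s) + 1 := by
    rw [length_revPrefix w ha2]
    omega
  let f (π : {π : Equiv.Perm (Fin n) // MemCa n s a π}) := rowData a π.1
  let g (w : {w : Equiv.Perm (Fin n) //
      PrefixInc n (s - 1) w ∧ ∀ b, n - s + 2 ≤ b → b ≤ a → ¬ MemCa n (s - 1) b w}) :=
    rowData a w.1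
  have hf : Function.Injective f := fun π π' heq =>
    Subtype.ext <| eq_of_rowData_eq (((hlate π.1).1 π.2).eq ((hlate π'.1).1 π'.2)
      (nodup_revPrefix _ _) (nodup_revPrefix _ _) (rowData_eq_iff.1 heq).1
      (rowData_eq_iff.1 heq).2.1) heq
  have hg : Function.Injective g := fun w w' heq =>
    Subtype.ext <| eq_of_rowData_eq (((hearly w.1).1 w.2).eq ((hearly w'.1).1 w'.2)
      (nodup_revPrefix _ _) (nodup_revPrefix _ _) (rowData_eq_iff.1 heq).1
      (rowData_eq_iff.1 heq).2.1) heq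
  have hfg (π) : ∃ w, g w = f π := by
    obtain ⟨l, hl, hlw, hR, hB⟩ :=
      ((hlate π.1).1 π.2).exists_earlyWord (nodup_revPrefix _ _) (hlen _)
    obtain ⟨w, hw, hdata⟩ := exists_perm_rowData_eq π.1 ha2 hl hR hB
    exact ⟨⟨w, (hearly w).2 (hw ▸ hlw)⟩, hdata⟩
  have hgf (w) : ∃ π, f π = g w := by
    obtain ⟨l, hl, hlw, hR, hB⟩ :=
      ((hearly w.1).1 w.2).exists_lateWord (nodup_revPrefix _ _) (hlen _)
    obtain ⟨π, hπ, hdata⟩ := exists_perm_rowData_eq w.1 ha2 hl hR hB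
    exact ⟨⟨π, (hlate π).2 (hπ ▸ hlw)⟩, hdata⟩
  choose φ hφ using hfg
  refine ⟨φ, ⟨fun π π' heq => hf ?_, fun w => ?_⟩, fun π i hi => ?_⟩
  · rw [← hφ π, ← hφ π', heq]
  · obtain ⟨π, hπ⟩ := hgf w
    exact ⟨π, hg ((hφ π).trans hπ)⟩
  · refine symm_lt_symm_iff (hφ π).symm (Fin.mk_lt_mk.2 i.lt_succ_self) fun y hy hy' => ?_
    rw [Fin.lt_def] at hy hy'
    simp only at hy hy'
    omega
end
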